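/- arXiv:2306.00847 — 3 statements merged into one kernel-verified Lean document; each statement's English description precedes it below -/
import Mathlib

section
/- (Ubiquity theorem in the inhomogeneous setup) Let m, n be positive integers, A ∈ M_{m,n}(ℝ), ψ : ℝ⁺ → ℝ⁺ decreasing, and ρ : ℝ⁺ → ℝ⁺ with ρ(r) → 0 as r → ∞. Let l = {l_i} and u = {u_i} be positive increasing sequences with l_i < u_i for all i and l_i → ∞. For i ≥ 1 set Δ_l^u(ρ,i) = ⋃_{q ∈ ℤ^n : l_i < ‖q‖ ≤ u_i} B(Aq, ρ(u_i)) ⊂ 𝕋^m. Assume: (local ubiquity) there is κ > 0 such that for every ball B ⊂ 𝕋^m there exists i_0(B) with |B ∩ Δ_l^u(ρ,i)| ≥ κ|B| for all i ≥ i_0(B); and (u-regularity) there is 0 < λ < 1 such that ρ(u_{i+1}) ≤ λ ρ(u_i) for all sufficiently large i. Then for any 0 ≤ s ≤ m: if ∑_{i=1}^∞ ψ(u_i)^s / ρ(u_i)^m = ∞, then ℋ^s(W_A(ψ)) = ℋ^s(𝕋^m). -/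
open MeasureTheory Filter

/-- The canonical projection `ℝ^m → 𝕋^m = (ℝ/ℤ)^m`. -/
noncomputable def torusProj {m : ℕ} (x : Fin m → ℝ) : Fin m → AddCircle (1 : ℝ) :=
  fun i => (x i : AddCircle (1 : ℝ))

/-- The set `W_A(ψ) ⊂ 𝕋^m` of `ψ`-approximable targets for `A`; the sup distance on
`𝕋^m` between `Aq mod ℤ^m` and `b` is exactly `‖Aq - b‖_ℤ`. -/
noncomputable def WAT (m n : ℕ) (A : Matrix (Fin m) (Fin n) ℝ) (ψ : ℝ → ℝ) :
    Set (Fin m → AddCircle (1 : ℝ)) :=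
  {b | {q : Fin n → ℤ |
    dist (torusProj (A.mulVec (fun j => (q j : ℝ)))) b < ψ ‖(fun j => (q j : ℝ))‖}.Infinite}

/-- `Δ_l^u(ρ, i) = ⋃_{q : l_i < ‖q‖ ≤ u_i} B(Aq, ρ(u_i)) ⊂ 𝕋^m`. -/
noncomputable def DeltaLU (m n : ℕ) (A : Matrix (Fin m) (Fin n) ℝ) (ρ : ℝ → ℝ)
    (l u : ℕ → ℝ) (i : ℕ) : Set (Fin m → AddCircle (1 : ℝ)) :=
  ⋃ q ∈ {q : Fin n → ℤ |
          l i < ‖(fun j => (q j : ℝ))‖ ∧ ‖(fun j => (q j : ℝ))‖ ≤ u i},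
    Metric.ball (torusProj (A.mulVec (fun j => (q j : ℝ)))) (ρ (u i))

section MetricMeasure

open Set Metric
open scoped ENNReal NNReal Topology

/-- A measure is Ahlfors `d`-regular with constant `C` if small balls of radius `r` have measure
comparable to `r ^ d`. -/
structure AhlforsRegular {X : Type*} [PseudoMetricSpace X] [MeasurableSpace X]
    (μ : Measure X) (d C : ℝ) : Prop where
  one_le : 1 ≤ C
  dim_pos : 0 < d
  le_ball : ∀ x r, 0 < r → r ≤ 1 → r ^ d ≤ C * μ.real (ball x r)
  closedBall_le : ∀ x r, 0 < r → μ.real (closedBall x r) ≤ C * r ^ d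

/-- A finite second moment inequality. -/
theorem two_mul_sum_measureReal_le {X ι : Type*} [MeasurableSpace X] (μ : Measure X)
    [IsFiniteMeasure μ] (I : Finset ι) (A : ι → Set X) (hA : ∀ i ∈ I, MeasurableSet (A i)) (τ : ℝ) :
    2 * τ * ∑ i ∈ I, μ.real (A i) ≤
      ∑ i ∈ I, ∑ j ∈ I, μ.real (A i ∩ A j) + τ ^ 2 * μ.real (⋃ i ∈ I, A i) := by
  set U := ⋃ i ∈ I, A i with hU
  have hUm : MeasurableSet U := Finset.measurableSet_biUnion I hA
  have hint : ∀ s : Set X, MeasurableSet s → Integrable (s.indicator (fun _ => (1 : ℝ))) μ :=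
    fun s hs => (integrable_const 1).indicator hs
  have hval : ∀ s : Set X, MeasurableSet s → ∫ x, s.indicator (fun _ => (1 : ℝ)) x ∂μ = μ.real s :=
    fun s hs => integral_indicator_one hs
  have hL : ∫ x, 2 * τ * ∑ i ∈ I, (A i).indicator (fun _ => (1 : ℝ)) x ∂μ =
      2 * τ * ∑ i ∈ I, μ.real (A i) := by
    rw [integral_const_mul, integral_finsetSum _ fun i hi => hint _ (hA i hi)]
    congr 1
    exact Finset.sum_congr rfl fun i hi => hval _ (hA i hi)
  have hR : ∫ x, ((∑ i ∈ I, ∑ j ∈ I, (A i ∩ A j).indicator (fun _ => (1 : ℝ)) x) +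
      τ ^ 2 * U.indicator (fun _ => (1 : ℝ)) x) ∂μ =
      ∑ i ∈ I, ∑ j ∈ I, μ.real (A i ∩ A j) + τ ^ 2 * μ.real U := by
    rw [integral_add, integral_const_mul, hval _ hUm, integral_finsetSum]
    · congr 1
      refine Finset.sum_congr rfl fun i hi => ?_
      rw [integral_finsetSum _ fun j hj => hint _ ((hA i hi).inter (hA j hj))]
      exact Finset.sum_congr rfl fun j hj => hval _ ((hA i hi).inter (hA j hj))
    · exact fun i hi => integrable_finsetSum _ fun j hj => hint _ ((hA i hi).inter (hA j hj))
    · exact integrable_finsetSum _ fun i hi =>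
        integrable_finsetSum _ fun j hj => hint _ ((hA i hi).inter (hA j hj))
    · exact (hint _ hUm).const_mul _
  rw [← hL, ← hR]
  refine integral_mono ?_ ?_ fun x => ?_
  · exact (integrable_finsetSum _ fun i hi => hint _ (hA i hi)).const_mul _
  · exact (integrable_finsetSum _ fun i hi =>
      integrable_finsetSum _ fun j hj => hint _ ((hA i hi).inter (hA j hj))).add
        ((hint _ hUm).const_mul _)
  · have hsq : ∑ i ∈ I, ∑ j ∈ I, (A i ∩ A j).indicator (fun _ => (1 : ℝ)) x =
        (∑ i ∈ I, (A i).indicator (fun _ => (1 : ℝ)) x) ^ 2 := by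
      rw [sq, Finset.sum_mul_sum]
      refine Finset.sum_congr rfl fun i _ => Finset.sum_congr rfl fun j _ => ?_
      rw [← Set.inter_indicator_mul]
      simp
    simp only [hsq]
    by_cases hx : x ∈ U
    · rw [indicator_of_mem hx]
      nlinarith [sq_nonneg (∑ i ∈ I, (A i).indicator (fun _ => (1 : ℝ)) x - τ)]
    · have h0 : ∑ i ∈ I, (A i).indicator (fun _ => (1 : ℝ)) x = 0 := by
        refine Finset.sum_eq_zero fun i hi => indicator_of_notMem (fun h => hx ?_) _
        exact mem_biUnion (Finset.mem_coe.2 hi) h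
      rw [h0, indicator_of_notMem hx]
      simp

/-- A union of quasi-independent events, with geometrically decaying diagonal terms, has measure
bounded below once the sum of the weights is at least one. -/
theorem le_measureReal_biUnion_of_quasiIndep {X : Type*} [MeasurableSpace X] (μ : Measure X)
    [IsFiniteMeasure μ] (I : Finset ℕ) (A : ℕ → Set X) (hA : ∀ i ∈ I, MeasurableSet (A i))
    (V : ℕ → ℝ) (hV : ∀ i ∈ I, 0 ≤ V i) {k K w θ : ℝ} (hk : 0 < k) (hK : 0 < K) (hw : 0 ≤ w)
    (hθ0 : 0 ≤ θ) (hθ1 : θ < 1) (hlow : ∀ i ∈ I, k * w * V i ≤ μ.real (A i))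
    (hup : ∀ i ∈ I, ∀ j ∈ I, i ≤ j →
      μ.real (A i ∩ A j) ≤ K * w * (V i * V j + θ ^ (j - i) * V j))
    (hsum : 1 ≤ ∑ i ∈ I, V i) :
    k ^ 2 / (2 * K * (1 + (1 - θ)⁻¹)) * w ≤ μ.real (⋃ i ∈ I, A i) := by
  set S := ∑ i ∈ I, V i with hS
  have hθ : 0 < 1 - θ := by linarith
  set K' := 2 * K * (1 + (1 - θ)⁻¹) with hK'
  have hK'pos : 0 < K' := by positivity
  have hgeom : ∀ n : ℕ, ∀ J : Finset ℕ, (∀ i ∈ J, i ≤ n) →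
      ∑ i ∈ J, θ ^ (n - i) ≤ (1 - θ)⁻¹ := by
    intro n J hJ
    rw [← tsum_geometric_of_lt_one hθ0 hθ1]
    have hinj : Set.InjOn (fun i => n - i) (J : Set ℕ) := by
      intro a ha b hb hab
      have := hJ a ha
      have := hJ b hb
      simp only at hab
      omega
    rw [← Finset.sum_image (f := fun m => θ ^ m) hinj]
    exact (summable_geometric_of_lt_one hθ0 hθ1).sum_le_tsum _ fun i _ => pow_nonneg hθ0 i
  have hhalf : ∑ j ∈ I, ∑ i ∈ I with i ≤ j, μ.real (A i ∩ A j) ≤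
      K * w * (1 + (1 - θ)⁻¹) * S ^ 2 := by
    have h1 : ∀ j ∈ I, ∑ i ∈ I with i ≤ j, μ.real (A i ∩ A j) ≤
        K * w * (S * V j + (1 - θ)⁻¹ * V j) := by
      intro j hj
      calc ∑ i ∈ I with i ≤ j, μ.real (A i ∩ A j)
          ≤ ∑ i ∈ I with i ≤ j, K * w * (V i * V j + θ ^ (j - i) * V j) := by
            refine Finset.sum_le_sum fun i hi => ?_
            rw [Finset.mem_filter] at hi
            exact hup i hi.1 j hj hi.2
        _ = K * w * ((∑ i ∈ I with i ≤ j, V i) * V j +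
              (∑ i ∈ I with i ≤ j, θ ^ (j - i)) * V j) := by
            rw [← Finset.mul_sum, Finset.sum_add_distrib, Finset.sum_mul, Finset.sum_mul]
        _ ≤ _ := by
            have := hV j hj
            gcongr
            · exact Finset.sum_le_sum_of_subset_of_nonneg (Finset.filter_subset _ _)
                fun i hi _ => hV i hi
            · exact hgeom j _ fun i hi => (Finset.mem_filter.1 hi).2
    refine (Finset.sum_le_sum h1).trans ?_
    rw [← Finset.mul_sum, Finset.sum_add_distrib, ← Finset.mul_sum, ← Finset.mul_sum, ← hS,
      mul_assoc (K * w)]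
    refine mul_le_mul_of_nonneg_left ?_ (by positivity)
    have : 0 < (1 - θ)⁻¹ := by positivity
    nlinarith [mul_nonneg this.le (mul_nonneg (zero_le_one.trans hsum) (sub_nonneg.2 hsum))]
  have hQ : ∑ i ∈ I, ∑ j ∈ I, μ.real (A i ∩ A j) ≤ K' * w * S ^ 2 := by
    have hsplit : ∑ i ∈ I, ∑ j ∈ I, μ.real (A i ∩ A j) ≤
        ∑ j ∈ I, ∑ i ∈ I with i ≤ j, μ.real (A i ∩ A j) +
        ∑ j ∈ I, ∑ i ∈ I with i ≤ j, μ.real (A i ∩ A j) := by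
      have e1 : ∑ j ∈ I, ∑ i ∈ I with i ≤ j, μ.real (A i ∩ A j) =
          ∑ i ∈ I, ∑ j ∈ I with i ≤ j, μ.real (A i ∩ A j) := by
        simp only [Finset.sum_filter]
        exact Finset.sum_comm
      have e2 : ∑ j ∈ I, ∑ i ∈ I with i ≤ j, μ.real (A i ∩ A j) =
          ∑ i ∈ I, ∑ j ∈ I with j ≤ i, μ.real (A i ∩ A j) := by
        simp only [inter_comm]
      nth_rewrite 1 [e1]
      rw [e2, ← Finset.sum_add_distrib]
      refine Finset.sum_le_sum fun i _ => ?_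
      rw [← Finset.sum_filter_add_sum_filter_not I (fun j => i ≤ j)]
      gcongr
      exact fun h => (not_le.1 h).le
    rw [hK']
    nlinarith
  have hmain := two_mul_sum_measureReal_le μ I A hA (K' * S / k)
  have hl : k * w * S ≤ ∑ i ∈ I, μ.real (A i) := by
    rw [hS, Finset.mul_sum]
    exact Finset.sum_le_sum hlow
  have hSpos : 0 < S := by linarith
  have h2 : 2 * (K' * S / k) * (k * w * S) ≤
      K' * w * S ^ 2 + (K' * S / k) ^ 2 * μ.real (⋃ i ∈ I, A i) :=
    (mul_le_mul_of_nonneg_left hl (by positivity)).trans (hmain.trans (by gcongr))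
  have h3 : 2 * (K' * S / k) * (k * w * S) = 2 * (K' * w * S ^ 2) := by
    field_simp
  have h4 : K' * w * S ^ 2 ≤ (K' * S / k) ^ 2 * μ.real (⋃ i ∈ I, A i) := by linarith
  rw [div_mul_eq_mul_div, div_le_iff₀ hK'pos]
  have h5 : (K' * S / k) ^ 2 * μ.real (⋃ i ∈ I, A i) =
      (K' * S ^ 2 / k ^ 2) * (μ.real (⋃ i ∈ I, A i) * K') := by
    field_simp
  have h6 : K' * w * S ^ 2 = (K' * S ^ 2 / k ^ 2) * (k ^ 2 * w) := by field_simp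
  rw [h5, h6] at h4
  exact le_of_mul_le_mul_left h4 (by positivity)

namespace AhlforsRegular

variable {X ι : Type*} [MetricSpace X] [MeasurableSpace X]
  {μ : Measure X} [IsFiniteMeasure μ] {d C : ℝ}

/-- From a family of balls of the same radius covering a proportion of a ball, one may extract a
disjoint subfamily whose cardinality is as large as possible. -/
theorem exists_disjoint_subfamily (h : AhlforsRegular μ d C) {J : Set ι} (hJ : J.Finite) (c : ι → X)
    {κ ρ r : ℝ} (hκ : 0 ≤ κ) (hρ : 0 < ρ) (hρr : ρ ≤ r) (hr1 : r ≤ 1) (x : X)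
    (hub : κ * μ.real (ball x r) ≤ μ.real (ball x r ∩ ⋃ q ∈ J, ball (c q) ρ)) :
    ∃ G : Finset ι, (∀ q ∈ G, q ∈ J) ∧ (∀ q ∈ G, dist (c q) x ≤ 2 * r) ∧
      ((G : Set ι).PairwiseDisjoint fun q => closedBall (c q) ρ) ∧
      κ / (C ^ 2 * 5 ^ d) * r ^ d ≤ G.card * ρ ^ d := by
  have hC : 0 < C := zero_lt_one.trans_le h.one_le
  obtain ⟨G, hGs, hGdisj, hGcov⟩ := Vitali.exists_disjoint_subfamily_covering_enlargement_closedBall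
    {q ∈ J | dist (c q) x ≤ 2 * r} c (fun _ => ρ) ρ (fun _ _ => le_rfl) 5 (by norm_num)
  have hGfin : G.Finite := hJ.subset fun q hq => (hGs hq).1
  lift G to Finset ι using hGfin
  refine ⟨G, fun q hq => (hGs hq).1, fun q hq => (hGs hq).2, hGdisj, ?_⟩
  have hcov : ball x r ∩ ⋃ q ∈ J, ball (c q) ρ ⊆ ⋃ q ∈ G, closedBall (c q) (5 * ρ) := by
    rintro z ⟨hz, hz'⟩
    simp only [mem_iUnion, exists_prop] at hz' ⊢
    obtain ⟨q, hq, hzq⟩ := hz'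
    have h1 := mem_ball.1 hz
    have h2 := mem_ball.1 hzq
    rw [dist_comm] at h2
    obtain ⟨b, hb, hsub⟩ := hGcov q ⟨hq, by linarith [dist_triangle (c q) z x]⟩
    exact ⟨b, hb, hsub (ball_subset_closedBall hzq)⟩
  have hkey : κ * r ^ d ≤ C ^ 2 * 5 ^ d * (G.card * ρ ^ d) := by
    calc κ * r ^ d ≤ κ * (C * μ.real (ball x r)) := by
          gcongr
          exact h.le_ball _ _ (by linarith) hr1
      _ = C * (κ * μ.real (ball x r)) := by ring
      _ ≤ C * μ.real (⋃ q ∈ G, closedBall (c q) (5 * ρ)) := by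
          gcongr
          exact hub.trans (measureReal_mono hcov (measure_ne_top _ _))
      _ ≤ C * ∑ q ∈ G, μ.real (closedBall (c q) (5 * ρ)) := by
          gcongr
          exact measureReal_biUnion_finset_le _ _
      _ ≤ C * ∑ q ∈ G, C * (5 * ρ) ^ d := by
          gcongr
          exact h.closedBall_le _ _ (by positivity)
      _ = _ := by
          rw [Finset.sum_const, nsmul_eq_mul, Real.mul_rpow (by norm_num) hρ.le]
          ring
  rw [div_mul_eq_mul_div, div_le_iff₀ (by positivity)]
  linarith

theorem isUnifLocDoublingMeasure (h : AhlforsRegular μ d C) : IsUnifLocDoublingMeasure μ := by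
  have hC : 0 < C := zero_lt_one.trans_le h.one_le
  refine ⟨(C * 2 ^ d * C).toNNReal, ?_⟩
  filter_upwards [Ioc_mem_nhdsGT zero_lt_one] with r hr x
  have h1 : μ.real (closedBall x (2 * r)) ≤ C * 2 ^ d * C * μ.real (closedBall x r) := by
    calc μ.real (closedBall x (2 * r)) ≤ C * (2 * r) ^ d := h.closedBall_le _ _ (by linarith [hr.1])
      _ = C * 2 ^ d * r ^ d := by rw [Real.mul_rpow (by norm_num) hr.1.le]; ring
      _ ≤ C * 2 ^ d * (C * μ.real (ball x r)) := by
        gcongr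
        exact h.le_ball _ _ hr.1 hr.2
      _ ≤ C * 2 ^ d * (C * μ.real (closedBall x r)) := by
        gcongr
        · exact measure_ne_top _ _
        · exact ball_subset_closedBall
      _ = _ := by ring
  rw [← ofReal_measureReal, ← ofReal_measureReal (s := closedBall x r)]
  change _ ≤ ENNReal.ofReal (C * 2 ^ d * C) * _
  rw [← ENNReal.ofReal_mul (by positivity)]
  exact ENNReal.ofReal_le_ofReal h1

variable [BorelSpace X]

theorem card_mul_rpow_le (h : AhlforsRegular μ d C) (G : Finset ι) (c : ι → X) {ρ t : ℝ}
    (hρ : 0 < ρ) (hρ1 : ρ ≤ 1) (ht : 0 ≤ t) (y : X)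
    (hdisj : (G : Set ι).PairwiseDisjoint fun q => closedBall (c q) ρ)
    (hG : ∀ q ∈ G, dist (c q) y ≤ t) :
    G.card * ρ ^ d ≤ C ^ 2 * (t + ρ) ^ d := by
  have hC : 0 < C := zero_lt_one.trans_le h.one_le
  have hdisj' : (G : Set ι).PairwiseDisjoint fun q => ball (c q) ρ :=
    hdisj.mono fun q => ball_subset_closedBall
  calc G.card * ρ ^ d = ∑ q ∈ G, ρ ^ d := by simp
    _ ≤ ∑ q ∈ G, C * μ.real (ball (c q) ρ) := Finset.sum_le_sum fun q _ => h.le_ball _ _ hρ hρ1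
    _ = C * μ.real (⋃ q ∈ G, ball (c q) ρ) := by
      rw [← Finset.mul_sum, measureReal_biUnion_finset hdisj' fun _ _ => measurableSet_ball]
    _ ≤ C * μ.real (closedBall y (t + ρ)) := by
      gcongr
      · exact measure_ne_top _ _
      refine iUnion₂_subset fun q hq z hz => ?_
      rw [mem_closedBall]
      have := mem_ball.1 hz
      linarith [dist_triangle z (c q) y, hG q hq]
    _ ≤ C * (C * (t + ρ) ^ d) := by
      gcongr
      exact h.closedBall_le _ _ (by linarith)
    _ = _ := by ring

/-- Overlap estimate for two levels of shrunk disjoint balls. -/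
theorem measureReal_inter_le (h : AhlforsRegular μ d C) (c : ι → X) (G G' : Finset ι)
    {ρ ρ' ω ω' r : ℝ} (hρ : 0 < ρ) (hρ' : 0 < ρ') (hρr : ρ ≤ r) (hρ1 : ρ ≤ 1) (hρ'1 : ρ' ≤ 1)
    (hω : 0 < ω) (hω' : 0 < ω') (hω'ρ' : ω' ≤ ρ') (x : X)
    (hG : (G : Set ι).PairwiseDisjoint fun q => closedBall (c q) ρ)
    (hGx : ∀ q ∈ G, dist (c q) x ≤ 2 * r)
    (hG' : (G' : Set ι).PairwiseDisjoint fun q => closedBall (c q) ρ') :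
    μ.real ((⋃ q ∈ G, ball (c q) ω) ∩ ⋃ q ∈ G', ball (c q) ω') ≤
      C ^ 5 * 12 ^ d * r ^ d *
        ((ω / ρ) ^ d * (ω' / ρ') ^ d + (ρ' / ρ) ^ d * (ω' / ρ') ^ d) := by
  classical
  have hC : 0 < C := zero_lt_one.trans_le h.one_le
  have hd := h.dim_pos
  have hr : 0 < r := hρ.trans_le hρr
  let N : ι → Finset ι := fun q => G'.filter fun q' => dist (c q') (c q) ≤ ω + ω'
  have hcov : (⋃ q ∈ G, ball (c q) ω) ∩ ⋃ q ∈ G', ball (c q) ω' ⊆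
      ⋃ q ∈ G, ⋃ q' ∈ N q, closedBall (c q') ω' := by
    rintro z ⟨hz, hz'⟩
    simp only [mem_iUnion, exists_prop, N, Finset.mem_filter] at hz hz' ⊢
    obtain ⟨q, hq, hzq⟩ := hz
    obtain ⟨q', hq', hzq'⟩ := hz'
    refine ⟨q, hq, q', ⟨hq', ?_⟩, ball_subset_closedBall hzq'⟩
    have h1 := mem_ball.1 hzq
    have h2 := mem_ball'.1 hzq'
    linarith [dist_triangle (c q') z (c q)]
  have hcount : ∀ q ∈ G, ((N q).card : ℝ) * ρ' ^ d ≤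
      C ^ 2 * (ω + ω' + ρ') ^ d := fun q _ =>
    h.card_mul_rpow_le _ c hρ' hρ'1 (by positivity) (c q)
      (hG'.subset (Finset.coe_subset.2 (Finset.filter_subset _ _))) fun q' hq' => (Finset.mem_filter.1 hq').2
  have hcountG : (G.card : ℝ) * ρ ^ d ≤ C ^ 2 * (3 * r) ^ d := by
    refine (h.card_mul_rpow_le G c hρ hρ1 (by positivity) x hG hGx).trans ?_
    gcongr
    linarith
  have hsum : (ω + ω' + ρ') ^ d ≤ 4 ^ d * (ω ^ d + ρ' ^ d) := by
    have h1 : ω + ω' + ρ' ≤ 4 * max ω ρ' := by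
      have := le_max_left ω ρ'
      have := le_max_right ω ρ'
      linarith
    calc (ω + ω' + ρ') ^ d ≤ (4 * max ω ρ') ^ d := by gcongr
      _ = 4 ^ d * (max ω ρ') ^ d := Real.mul_rpow (by norm_num) (by positivity)
      _ ≤ _ := by
        gcongr
        rcases max_choice ω ρ' with e | e <;> rw [e]
        · exact le_add_of_nonneg_right (by positivity)
        · exact le_add_of_nonneg_left (by positivity)
  have hpt : ∀ q ∈ G, μ.real (⋃ q' ∈ N q, closedBall (c q') ω') ≤
      C ^ 3 * 4 ^ d * (ω ^ d + ρ' ^ d) * (ω' / ρ') ^ d := by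
    intro q hq
    calc μ.real (⋃ q' ∈ N q, closedBall (c q') ω')
        ≤ ∑ q' ∈ N q, μ.real (closedBall (c q') ω') :=
          measureReal_biUnion_finset_le _ _
      _ ≤ ∑ q' ∈ N q, C * ω' ^ d :=
          Finset.sum_le_sum fun _ _ => h.closedBall_le _ _ hω'
      _ = C * (((N q).card : ℝ) * ρ' ^ d) *
            (ω' / ρ') ^ d := by
          rw [Finset.sum_const, nsmul_eq_mul, Real.div_rpow hω'.le hρ'.le]
          field_simp
      _ ≤ C * (C ^ 2 * (4 ^ d * (ω ^ d + ρ' ^ d))) * (ω' / ρ') ^ d := by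
          gcongr C * ?_ * _
          exact (hcount q hq).trans (by gcongr)
      _ = _ := by ring
  calc _ ≤ μ.real (⋃ q ∈ G, ⋃ q' ∈ N q, closedBall (c q') ω') :=
        measureReal_mono hcov (measure_ne_top _ _)
    _ ≤ ∑ q ∈ G, μ.real (⋃ q' ∈ N q, closedBall (c q') ω') :=
        measureReal_biUnion_finset_le _ _
    _ ≤ ∑ q ∈ G, C ^ 3 * 4 ^ d * (ω ^ d + ρ' ^ d) * (ω' / ρ') ^ d := Finset.sum_le_sum hpt
    _ = C ^ 3 * 4 ^ d * (G.card * ρ ^ d) *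
          ((ω / ρ) ^ d * (ω' / ρ') ^ d + (ρ' / ρ) ^ d * (ω' / ρ') ^ d) := by
        rw [Finset.sum_const, nsmul_eq_mul, Real.div_rpow hω.le hρ.le, Real.div_rpow hρ'.le hρ.le]
        field_simp
    _ ≤ C ^ 3 * 4 ^ d * (C ^ 2 * (3 * r) ^ d) *
          ((ω / ρ) ^ d * (ω' / ρ') ^ d + (ρ' / ρ) ^ d * (ω' / ρ') ^ d) := by
        gcongr
    _ = _ := by
        rw [Real.mul_rpow (by norm_num) hr.le, show (12 : ℝ) = 4 * 3 by norm_num,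
          Real.mul_rpow (by norm_num) (by norm_num)]
        ring

end AhlforsRegular

/-- A sequence of families of points is locally ubiquitous at scales `ρ i`, the scales decaying at
least geometrically. -/
structure LocallyUbiquitous {X ι : Type*} [PseudoMetricSpace X] [MeasurableSpace X] (μ : Measure X)
    (J : ℕ → Set ι) (c : ι → X) (ρ : ℕ → ℝ) : Prop where
  finite : ∀ i, (J i).Finite
  pos : ∀ i, 0 < ρ i
  tendsto_zero : Tendsto ρ atTop (𝓝 0)
  exists_le_measureReal : ∃ κ > 0, ∀ x r, 0 < r → ∀ᶠ i in atTop,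
    κ * μ.real (ball x r) ≤ μ.real (ball x r ∩ ⋃ q ∈ J i, ball (c q) (ρ i))
  exists_le_mul : ∃ lam : ℝ, 0 ≤ lam ∧ lam < 1 ∧ ∀ᶠ i in atTop, ρ (i + 1) ≤ lam * ρ i

namespace LocallyUbiquitous

variable {X ι : Type*} [MetricSpace X] [MeasurableSpace X] [BorelSpace X]
  {μ : Measure X} [IsFiniteMeasure μ] {d C : ℝ} {J : ℕ → Set ι} {c : ι → X} {ρ ω : ℕ → ℝ}

theorem exists_le_measureReal_inter (hu : LocallyUbiquitous μ J c ρ) (h : AhlforsRegular μ d C)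
    (hω : ∀ i, 0 < ω i) (hωρ : ∀ i, ω i ≤ ρ i) (hdiv : ¬ Summable fun i => (ω i / ρ i) ^ d) :
    ∃ k > 0, ∀ x r, 0 < r → r ≤ 1 → ∀ N : ℕ, k * r ^ d ≤
      μ.real (closedBall x (3 * r) ∩ ⋃ i ≥ N, ⋃ q ∈ J i, ball (c q) (ω i)) := by
  obtain ⟨κ, hκ, hub⟩ := hu.exists_le_measureReal
  obtain ⟨lam, hlam0, hlam1, hreg⟩ := hu.exists_le_mul
  have hC : 0 < C := zero_lt_one.trans_le h.one_le
  have hd := h.dim_pos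
  have hρ := hu.pos
  have hθ1 : lam ^ d < 1 := Real.rpow_lt_one hlam0 hlam1 hd
  have hθ : 0 < 1 - lam ^ d := by linarith
  set V : ℕ → ℝ := fun i => (ω i / ρ i) ^ d with hVdef
  have hV : ∀ i, 0 ≤ V i := fun i => Real.rpow_nonneg (div_nonneg (hω i).le (hρ i).le) _
  refine ⟨(κ / (C ^ 2 * 5 ^ d) / C) ^ 2 / (2 * (C ^ 5 * 12 ^ d) * (1 + (1 - lam ^ d)⁻¹)),
    by positivity, fun x r hr hr1 N => ?_⟩
  obtain ⟨N₁, hN₁⟩ := eventually_atTop.1 ((eventually_ge_atTop N).and ((hub x r hr).and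
    (hreg.and (hu.tendsto_zero.eventually (eventually_le_nhds hr)))))
  have hG : ∀ i, ∃ G : Finset ι, N₁ ≤ i → (∀ q ∈ G, q ∈ J i) ∧ (∀ q ∈ G, dist (c q) x ≤ 2 * r) ∧
      ((G : Set ι).PairwiseDisjoint fun q => closedBall (c q) (ρ i)) ∧
      κ / (C ^ 2 * 5 ^ d) * r ^ d ≤ G.card * ρ i ^ d := by
    intro i
    by_cases hi : N₁ ≤ i
    · obtain ⟨G, hG⟩ := h.exists_disjoint_subfamily (hu.finite i) c hκ.le (hρ i) (hN₁ i hi).2.2.2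
        hr1 x (hN₁ i hi).2.1
      exact ⟨G, fun _ => hG⟩
    · exact ⟨∅, fun hi' => absurd hi' hi⟩
  choose G hG using hG
  set A : ℕ → Set X := fun i => ⋃ q ∈ G i, ball (c q) (ω i) with hA
  have hAm : ∀ i, MeasurableSet (A i) := fun i =>
    Finset.measurableSet_biUnion _ fun _ _ => measurableSet_ball
  have hdecay : ∀ i, N₁ ≤ i → ∀ n, ρ (i + n) ≤ lam ^ n * ρ i := by
    intro i hi n
    induction n with
    | zero => simp
    | succ n ih =>
      calc ρ (i + n + 1) ≤ lam * ρ (i + n) := (hN₁ (i + n) (by omega)).2.2.1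
        _ ≤ lam * (lam ^ n * ρ i) := by gcongr
        _ = _ := by ring
  obtain ⟨n, hn⟩ : ∃ n, 1 ≤ ∑ i ∈ Finset.Ico N₁ (N₁ + n), V i := by
    have hns : ¬ Summable fun i => V (N₁ + i) := by
      intro hs
      simp only [add_comm N₁] at hs
      exact hdiv ((summable_nat_add_iff N₁).1 hs)
    have := (not_summable_iff_tendsto_nat_atTop_of_nonneg fun i => hV _).1 hns
    obtain ⟨n, hn⟩ := (this.eventually (eventually_ge_atTop 1)).exists
    refine ⟨n, ?_⟩
    rwa [Finset.sum_Ico_eq_sum_range, Nat.add_sub_cancel_left]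
  have key := le_measureReal_biUnion_of_quasiIndep μ (Finset.Ico N₁ (N₁ + n)) A (fun i _ => hAm i) V
    (fun i _ => hV i) (k := κ / (C ^ 2 * 5 ^ d) / C) (K := C ^ 5 * 12 ^ d) (w := r ^ d)
    (θ := lam ^ d) (by positivity) (by positivity) (by positivity) (by positivity) hθ1 ?_ ?_ hn
  · refine key.trans (measureReal_mono ?_ (measure_ne_top _ _))
    refine iUnion₂_subset fun i hi => iUnion₂_subset fun q hq z hz => ⟨?_, ?_⟩
    · have hi' := (Finset.mem_Ico.1 hi).1
      have h1 := (hG i hi').2.1 q hq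
      have h2 := mem_ball.1 hz
      have h3 := (hN₁ i hi').2.2.2
      rw [mem_closedBall]
      linarith [dist_triangle z (c q) x, hωρ i]
    · have hi' := (Finset.mem_Ico.1 hi).1
      simp only [mem_iUnion, exists_prop]
      exact ⟨i, (hN₁ i hi').1, q, (hG i hi').1 q hq, hz⟩
  · intro i hi
    have hi' := (Finset.mem_Ico.1 hi).1
    obtain ⟨-, -, hdisj, hcard⟩ := hG i hi'
    have hdisj' : ((G i : Set ι)).PairwiseDisjoint fun q => ball (c q) (ω i) :=
      hdisj.mono fun q => ball_subset_closedBall.trans (closedBall_subset_closedBall (hωρ i))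
    have hωr : ω i ≤ 1 := (hωρ i).trans ((hN₁ i hi').2.2.2.trans hr1)
    calc κ / (C ^ 2 * 5 ^ d) / C * r ^ d * V i = (κ / (C ^ 2 * 5 ^ d) * r ^ d) * V i / C := by ring
      _ ≤ ((G i).card * ρ i ^ d) * V i / C := by
        have := hV i
        gcongr
      _ = ∑ q ∈ G i, ω i ^ d / C := by
        have := (Real.rpow_pos_of_pos (hρ i) d).ne'
        rw [Finset.sum_const, nsmul_eq_mul, hVdef]
        simp only [Real.div_rpow (hω i).le (hρ i).le]
        field_simp
      _ ≤ ∑ q ∈ G i, μ.real (ball (c q) (ω i)) := by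
        refine Finset.sum_le_sum fun q _ => ?_
        rw [div_le_iff₀' hC]
        exact h.le_ball _ _ (hω i) hωr
      _ = μ.real (A i) :=
        (measureReal_biUnion_finset hdisj' fun _ _ => measurableSet_ball).symm
  · intro i hi j hj hij
    have hi' := (Finset.mem_Ico.1 hi).1
    have hj' := (Finset.mem_Ico.1 hj).1
    refine (h.measureReal_inter_le c (G i) (G j) (hρ i) (hρ j) (hN₁ i hi').2.2.2
      ((hN₁ i hi').2.2.2.trans hr1) ((hN₁ j hj').2.2.2.trans hr1) (hω i) (hω j) (hωρ j) x
      (hG i hi').2.2.1 (hG i hi').2.1 (hG j hj').2.2.1).trans ?_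
    have hVj := hV j
    have hratio : (ρ j / ρ i) ^ d ≤ (lam ^ d) ^ (j - i) := by
      rw [Real.rpow_pow_comm hlam0]
      refine Real.rpow_le_rpow (div_nonneg (hρ j).le (hρ i).le) ?_ hd.le
      rw [div_le_iff₀ (hρ i)]
      have := hdecay i hi' (j - i)
      rwa [Nat.add_sub_cancel' hij] at this
    gcongr

/-- **Ubiquity, Lebesgue case**: the balls of radii `ω i` cover almost every point infinitely
often. -/
theorem ae_frequently_mem (hu : LocallyUbiquitous μ J c ρ) [SecondCountableTopology X]
    (h : AhlforsRegular μ d C)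
    (hω : ∀ i, 0 < ω i) (hωρ : ∀ i, ω i ≤ ρ i) (hdiv : ¬ Summable fun i => (ω i / ρ i) ^ d) :
    ∀ᵐ x ∂μ, ∃ᶠ i in atTop, x ∈ ⋃ q ∈ J i, ball (c q) (ω i) := by
  obtain ⟨k, hk, hcore⟩ := hu.exists_le_measureReal_inter h hω hωρ hdiv
  have hC : 0 < C := zero_lt_one.trans_le h.one_le
  have := h.isUnifLocDoublingMeasure
  suffices H : ∀ N : ℕ, ∀ᵐ x ∂μ, x ∈ ⋃ i ≥ N, ⋃ q ∈ J i, ball (c q) (ω i) by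
    filter_upwards [ae_all_iff.2 H] with x hx
    refine frequently_atTop.2 fun N => ?_
    obtain ⟨i, hi, hxi⟩ := mem_iUnion₂.1 (hx N)
    exact ⟨i, hi, hxi⟩
  intro N
  set U := ⋃ i ≥ N, ⋃ q ∈ J i, ball (c q) (ω i) with hU
  have hUo : IsOpen U := isOpen_biUnion fun i _ => isOpen_biUnion fun q _ => isOpen_ball
  by_contra hne
  have hne' : μ Uᶜ ≠ 0 := hne
  have hr0 : μ.restrict Uᶜ ≠ 0 := fun h0 => hne' (Measure.restrict_eq_zero.1 h0)
  have := ae_neBot.2 hr0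
  obtain ⟨x, hx⟩ := (IsUnifLocDoublingMeasure.ae_tendsto_measure_inter_div μ Uᶜ 1).exists
  have hlim := hx (l := 𝓝[>] (0 : ℝ)) (fun _ => x) (fun r => 3 * r) (by
      refine tendsto_nhdsWithin_iff.2 ⟨?_, ?_⟩
      · refine (Continuous.tendsto' (by fun_prop) _ _ (by simp)).mono_left nhdsWithin_le_nhds
      · filter_upwards [self_mem_nhdsWithin] with r hr
        exact mul_pos (by norm_num : (0 : ℝ) < 3) hr) (by
      filter_upwards [self_mem_nhdsWithin] with r hr
      have : (0 : ℝ) < r := hr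
      exact mem_closedBall_self (by linarith))
  have hlim' := (ENNReal.tendsto_toReal ENNReal.one_ne_top).comp hlim
  have hle : (1 : ENNReal).toReal ≤ 1 - k / (C * 3 ^ d) := by
    refine le_of_tendsto hlim' ?_
    filter_upwards [Ioc_mem_nhdsGT zero_lt_one] with r hr
    have hr0 := hr.1
    have hB : 0 < μ.real (closedBall x (3 * r)) := by
      have h1 := h.le_ball x r hr0 hr.2
      have h2 : 0 < r ^ d := Real.rpow_pos_of_pos hr0 _
      have h3 : 0 < μ.real (ball x r) := pos_of_mul_pos_right (h2.trans_le h1) hC.le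
      refine h3.trans_le (measureReal_mono (ball_subset_closedBall.trans
        (closedBall_subset_closedBall (by linarith))) (measure_ne_top _ _))
    have h1 : μ.real (Uᶜ ∩ closedBall x (3 * r)) + μ.real (closedBall x (3 * r) ∩ U) =
        μ.real (closedBall x (3 * r)) := by
      rw [inter_comm, ← sdiff_eq, add_comm]
      exact measureReal_inter_add_sdiff hUo.measurableSet
    have h2 := hcore x r hr0 hr.2 N
    have h3 := h.closedBall_le x (3 * r) (by linarith)
    rw [Real.mul_rpow (by norm_num) hr0.le] at h3
    simp only [Function.comp_apply, ENNReal.toReal_div]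
    change μ.real (Uᶜ ∩ closedBall x (3 * r)) / μ.real (closedBall x (3 * r)) ≤ _
    rw [div_le_iff₀ hB]
    have h4 : k / (C * 3 ^ d) * μ.real (closedBall x (3 * r)) ≤ k * r ^ d := by
      calc _ ≤ k / (C * 3 ^ d) * (C * (3 ^ d * r ^ d)) := by gcongr
        _ = _ := by field_simp
    linarith
  have : 0 < k / (C * 3 ^ d) := by positivity
  simp only [ENNReal.toReal_one] at hle
  linarith

end LocallyUbiquitous

/-- The measure obtained from `ν` by moving the mass of each closed ball `closedBall (y j) (R j)`
uniformly to the smaller ball `ball (y j) (p j)`. -/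
noncomputable def concentrate {X β : Type*} [PseudoMetricSpace X] [MeasurableSpace X]
    (μ ν : Measure X) (F : Finset β) (y : β → X) (R p : β → ℝ) : Measure X :=
  ∑ j ∈ F, (ν (closedBall (y j) (R j)) / μ (ball (y j) (p j))) • μ.restrict (ball (y j) (p j))

namespace AhlforsRegular

variable {X β : Type*} [MetricSpace X] [MeasurableSpace X]
  {μ ν : Measure X} {d C : ℝ} {M : ℝ≥0} {F : Finset β} {y : β → X} {R p : β → ℝ}

theorem measure_ball_pos (h : AhlforsRegular μ d C) (x : X) {r : ℝ} (hr : 0 < r) :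
    0 < μ (ball x r) := by
  have hC : 0 < C := zero_lt_one.trans_le h.one_le
  have h1 := h.le_ball x (min r 1) (by positivity) (min_le_right _ _)
  have h2 : 0 < μ.real (ball x (min r 1)) :=
    pos_of_mul_pos_right ((Real.rpow_pos_of_pos (by positivity) d).trans_le h1) hC.le
  refine (ENNReal.toReal_pos_iff.1 h2).1.trans_le (measure_mono (ball_subset_ball (min_le_left _ _)))

theorem concentrate_compl [BorelSpace X] : concentrate μ ν F y R p (⋃ j ∈ F, ball (y j) (p j))ᶜ = 0 := by
  simp only [concentrate, Measure.coe_finsetSum, Finset.sum_apply, Measure.smul_apply, smul_eq_mul]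
  refine Finset.sum_eq_zero fun j hj => ?_
  rw [Measure.restrict_apply' measurableSet_ball]
  have : (⋃ j ∈ F, ball (y j) (p j))ᶜ ∩ ball (y j) (p j) = ∅ := by
    ext z
    simp only [mem_inter_iff, mem_compl_iff, mem_iUnion, mem_empty_iff_false, iff_false, not_and,
      exists_prop]
    exact fun h1 h2 => h1 ⟨j, hj, h2⟩
  rw [this, measure_empty, mul_zero]

variable [IsFiniteMeasure μ]

theorem measure_closedBall_le_of_le_smul (h : AhlforsRegular μ d C) (hν : ν ≤ M • μ) (x : X) {r : ℝ}
    (hr : 0 < r) : ν (closedBall x r) ≤ ENNReal.ofReal (M * C * r ^ d) := by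
  have h1 : μ (closedBall x r) ≤ ENNReal.ofReal (C * r ^ d) := by
    rw [← ofReal_measureReal]
    exact ENNReal.ofReal_le_ofReal (h.closedBall_le x r hr)
  calc ν (closedBall x r) ≤ (M • μ) (closedBall x r) := hν _
    _ = (M : ℝ≥0∞) * μ (closedBall x r) := rfl
    _ ≤ M * ENNReal.ofReal (C * r ^ d) := by gcongr
    _ = _ := by
      rw [mul_assoc, ENNReal.ofReal_mul (p := (M : ℝ)) M.2, ENNReal.ofReal_coe_nnreal]

theorem concentrate_univ (h : AhlforsRegular μ d C) (hp : ∀ j ∈ F, 0 < p j) :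
    concentrate μ ν F y R p univ = ∑ j ∈ F, ν (closedBall (y j) (R j)) := by
  simp only [concentrate, Measure.coe_finsetSum, Finset.sum_apply, Measure.smul_apply, smul_eq_mul,
    Measure.restrict_apply_univ]
  exact Finset.sum_congr rfl fun j hj =>
    ENNReal.div_mul_cancel (h.measure_ball_pos _ (hp j hj)).ne' (measure_ne_top _ _)

theorem exists_concentrate_le_smul (h : AhlforsRegular μ d C) (hν : ν ≤ M • μ)
    (hp : ∀ j ∈ F, 0 < p j) : ∃ M' : ℝ≥0, concentrate μ ν F y R p ≤ M' • μ := by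
  have hfin : ∑ j ∈ F, ν (closedBall (y j) (R j)) / μ (ball (y j) (p j)) ≠ ∞ := by
    refine ENNReal.sum_ne_top.2 fun j hj => ?_
    refine ENNReal.div_ne_top (ne_top_of_le_ne_top ?_ (hν _)) (h.measure_ball_pos _ (hp j hj)).ne'
    exact ENNReal.mul_ne_top ENNReal.coe_ne_top (measure_ne_top _ _)
  refine ⟨(∑ j ∈ F, ν (closedBall (y j) (R j)) / μ (ball (y j) (p j))).toNNReal, fun S => ?_⟩
  change _ ≤ ((∑ j ∈ F, ν (closedBall (y j) (R j)) / μ (ball (y j) (p j))).toNNReal : ℝ≥0∞) * μ S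
  rw [ENNReal.coe_toNNReal hfin, Finset.sum_mul]
  simp only [concentrate, Measure.coe_finsetSum, Finset.sum_apply, Measure.smul_apply, smul_eq_mul]
  gcongr
  exact Measure.restrict_le_self

variable [BorelSpace X]

/-- If the radii are chosen appropriately, concentrating the mass of `ν` preserves a Frostman type
bound. -/
theorem concentrate_closedBall_le (h : AhlforsRegular μ d C) (hν : ν ≤ M • μ) {s b r₀ r₁ δ : ℝ}
    (hs : 0 ≤ s) (hsd : s ≤ d) (hb : 0 ≤ b) (hδ : δ ≤ 1) (hp : ∀ j ∈ F, 0 < p j)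
    (hpR : ∀ j ∈ F, 8 * p j ≤ R j) (hR : ∀ j ∈ F, R j ≤ δ)
    (hdisj : (F : Set β).PairwiseDisjoint fun j => closedBall (y j) (R j))
    (hsmall : ∀ r, 0 < r → r ≤ r₁ → M * C * (9 * r) ^ d ≤ b * r ^ s)
    (hbig : ∀ j ∈ F, M * C ^ 3 * R j ^ d ≤ b * p j ^ s)
    (hmid : ∀ x r, r₁ ≤ r → r ≤ r₀ →
      ν (closedBall x (r + 2 * δ)) ≤ ENNReal.ofReal (2 * b * r ^ s))
    (x : X) {r : ℝ} (hr : 0 < r) (hrr : r ≤ r₀) :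
    concentrate μ ν F y R p (closedBall x r) ≤ ENNReal.ofReal (2 * b * r ^ s) := by
  classical
  have hC1 := h.one_le
  have hC : 0 < C := zero_lt_one.trans_le hC1
  have hM : (0 : ℝ) ≤ M := M.2
  have hRpos : ∀ j ∈ F, 0 < R j := fun j hj => by linarith [hp j hj, hpR j hj]
  set T : β → ℝ≥0∞ := fun j => ν (closedBall (y j) (R j)) / μ (ball (y j) (p j)) *
    μ (closedBall x r ∩ ball (y j) (p j)) with hT
  have hsum : concentrate μ ν F y R p (closedBall x r) = ∑ j ∈ F, T j := by
    simp only [concentrate, Measure.coe_finsetSum, Finset.sum_apply, Measure.smul_apply,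
      smul_eq_mul, Measure.restrict_apply' measurableSet_ball, hT]
  have hT1 : ∀ j ∈ F, T j ≤ ν (closedBall (y j) (R j)) := by
    intro j hj
    calc T j ≤ ν (closedBall (y j) (R j)) / μ (ball (y j) (p j)) * μ (ball (y j) (p j)) := by
          simp only [hT]
          gcongr
          exact inter_subset_right
      _ = _ := ENNReal.div_mul_cancel (h.measure_ball_pos _ (hp j hj)).ne' (measure_ne_top _ _)
  have hT2 : ∀ j, T j ≠ 0 → dist (y j) x ≤ r + p j := by
    intro j hj
    by_contra hlt
    refine hj ?_
    have : closedBall x r ∩ ball (y j) (p j) = ∅ := by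
      ext z
      simp only [mem_inter_iff, mem_closedBall, mem_ball, mem_empty_iff_false, iff_false, not_and,
        not_lt]
      intro hz
      linarith [dist_triangle_left (y j) x z]
    simp only [hT, this, measure_empty, mul_zero]
  have hT3 : ∀ j ∈ F, T j ≤ ENNReal.ofReal (b * r ^ s) := by
    intro j hj
    have hpj := hp j hj
    have hRj := hRpos j hj
    have hνB := h.measure_closedBall_le_of_le_smul hν (y j) hRj
    rcases le_or_gt (p j) r with hle | hlt
    · refine (hT1 j hj).trans (hνB.trans (ENNReal.ofReal_le_ofReal ?_))
      calc M * C * R j ^ d ≤ M * C ^ 3 * R j ^ d := by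
            gcongr
            exact le_self_pow₀ hC1 (by norm_num)
        _ ≤ b * p j ^ s := hbig j hj
        _ ≤ b * r ^ s := by gcongr
    · have hpd : 0 < p j ^ d := Real.rpow_pos_of_pos hpj _
      have hlow : ENNReal.ofReal (p j ^ d / C) ≤ μ (ball (y j) (p j)) := by
        rw [← ofReal_measureReal]
        refine ENNReal.ofReal_le_ofReal ((div_le_iff₀' hC).2 (h.le_ball _ _ hpj ?_))
        linarith [hpR j hj, hR j hj]
      have hup : μ (closedBall x r ∩ ball (y j) (p j)) ≤ ENNReal.ofReal (C * r ^ d) := by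
        refine (measure_mono inter_subset_left).trans ?_
        rw [← ofReal_measureReal]
        exact ENNReal.ofReal_le_ofReal (h.closedBall_le x r hr)
      calc T j ≤ ENNReal.ofReal (M * C * R j ^ d) / ENNReal.ofReal (p j ^ d / C) *
            ENNReal.ofReal (C * r ^ d) := by
            simp only [hT]
            gcongr
        _ = ENNReal.ofReal (M * C ^ 3 * R j ^ d * (r / p j) ^ d) := by
            rw [← ENNReal.ofReal_div_of_pos (by positivity), ← ENNReal.ofReal_mul (by positivity),
              Real.div_rpow hr.le hpj.le]
            congr 1
            field_simp
        _ ≤ ENNReal.ofReal (b * p j ^ s * (r / p j) ^ s) := by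
            refine ENNReal.ofReal_le_ofReal ?_
            have h1 : (r / p j) ^ d ≤ (r / p j) ^ s :=
              Real.rpow_le_rpow_of_exponent_ge (by positivity) ((div_le_one hpj).2 hlt.le) hsd
            have := hbig j hj
            gcongr
        _ = ENNReal.ofReal (b * r ^ s) := by
            have : 0 < p j ^ s := Real.rpow_pos_of_pos hpj _
            rw [Real.div_rpow hr.le hpj.le]
            congr 1
            field_simp
  have hcollect : ∀ (G : Finset β) (t : ℝ), G ⊆ F → (∀ j ∈ G, dist (y j) x + R j ≤ t) →
      ∑ j ∈ G, T j ≤ ν (closedBall x t) := by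
    intro G t hGF hG
    calc ∑ j ∈ G, T j ≤ ∑ j ∈ G, ν (closedBall (y j) (R j)) :=
          Finset.sum_le_sum fun j hj => hT1 j (hGF hj)
      _ = ν (⋃ j ∈ G, closedBall (y j) (R j)) :=
          (measure_biUnion_finset (hdisj.subset (Finset.coe_subset.2 hGF))
            fun _ _ => measurableSet_closedBall).symm
      _ ≤ ν (closedBall x t) := by
          refine measure_mono (iUnion₂_subset fun j hj z hz => ?_)
          rw [mem_closedBall] at hz ⊢
          linarith [dist_triangle z (y j) x, hG j hj]
  rw [hsum, ← Finset.sum_filter_ne_zero]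
  have hF' : ∀ j ∈ F.filter (fun j => T j ≠ 0), j ∈ F ∧ dist (y j) x ≤ r + p j := fun j hj =>
    ⟨(Finset.mem_filter.1 hj).1, hT2 j (Finset.mem_filter.1 hj).2⟩
  rcases le_or_gt r₁ r with hr1 | hr1
  · refine (hcollect _ (r + 2 * δ) (Finset.filter_subset _ _) fun j hj => ?_).trans
      (hmid x r hr1 hrr)
    obtain ⟨hjF, hjx⟩ := hF' j hj
    linarith [hpR j hjF, hR j hjF, hRpos j hjF]
  · rw [← Finset.sum_filter_add_sum_filter_not _ (fun j => R j ≤ 4 * r), two_mul, add_mul,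
      ENNReal.ofReal_add (by positivity) (by positivity)]
    refine add_le_add ?_ ?_
    · refine (hcollect _ (9 * r) ?_ fun j hj => ?_).trans
        ((h.measure_closedBall_le_of_le_smul hν x (by positivity)).trans
          (ENNReal.ofReal_le_ofReal (hsmall r hr hr1.le)))
      · exact (Finset.filter_subset _ _).trans (Finset.filter_subset _ _)
      · obtain ⟨hj, hj4⟩ := Finset.mem_filter.1 hj
        obtain ⟨hjF, hjx⟩ := hF' j hj
        linarith [hpR j hjF]
    · set G := (F.filter fun j => T j ≠ 0).filter fun j => ¬ R j ≤ 4 * r with hG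
      have hcard : G.card ≤ 1 := by
        refine Finset.card_le_one.2 fun j hj k hk => ?_
        by_contra hjk
        obtain ⟨hj, hj4⟩ := Finset.mem_filter.1 hj
        obtain ⟨hjF, hjx⟩ := hF' j hj
        obtain ⟨hk, hk4⟩ := Finset.mem_filter.1 hk
        obtain ⟨hkF, hkx⟩ := hF' k hk
        rw [not_le] at hj4 hk4
        have hdist : dist (y j) (y k) ≤ max (R j) (R k) := by
          have := dist_triangle_right (y j) (y k) x
          have := le_max_left (R j) (R k)
          have := le_max_right (R j) (R k)
          linarith [hpR j hjF, hpR k hkF]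
        rcases le_max_iff.1 hdist with hd | hd
        · exact disjoint_left.1 (hdisj (Finset.mem_coe.2 hjF) (Finset.mem_coe.2 hkF) hjk)
            (mem_closedBall'.2 hd) (mem_closedBall_self (hRpos k hkF).le)
        · exact disjoint_left.1 (hdisj (Finset.mem_coe.2 hjF) (Finset.mem_coe.2 hkF) hjk)
            (mem_closedBall_self (hRpos j hjF).le) (mem_closedBall.2 hd)
      calc ∑ j ∈ G, T j ≤ G.card • ENNReal.ofReal (b * r ^ s) :=
            Finset.sum_le_card_nsmul _ _ _ fun j hj => hT3 j
              (hF' j (Finset.mem_filter.1 hj).1).1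
        _ ≤ 1 • ENNReal.ofReal (b * r ^ s) := by gcongr
        _ = _ := one_smul _ _

end AhlforsRegular

/-- The measure `ν` is concentrated on the open set `U`, has bounded density with respect to `μ`,
total mass more than `m₀`, and satisfies a Frostman type bound with constant less than `A` for all
radii up to some number larger than `R₀`. -/
structure FrostmanOn {X : Type*} [PseudoMetricSpace X] [MeasurableSpace X] (μ : Measure X)
    (s A R₀ : ℝ) (m₀ : ℝ≥0∞) (ν : Measure X) (U : Set X) : Prop where
  isOpen : IsOpen U
  exists_le_smul : ∃ M : ℝ≥0, ν ≤ M • μ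
  compl_eq_zero : ν Uᶜ = 0
  lt_univ : m₀ < ν univ
  exists_closedBall_le : ∃ a, 0 ≤ a ∧ a < A ∧ ∃ r₀, R₀ < r₀ ∧
    ∀ x r, 0 < r → r ≤ r₀ → ν (closedBall x r) ≤ ENNReal.ofReal (a * r ^ s)

theorem not_summable_min_one {a : ℕ → ℝ} (ha : ¬ Summable a) :
    ¬ Summable fun i => min (a i) 1 := by
  intro hs
  refine ha ((summable_congr_atTop ?_).1 hs)
  filter_upwards [hs.tendsto_atTop_zero.eventually (eventually_lt_nhds zero_lt_one)] with i hi
  rcases min_lt_iff.1 hi with h | h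
  · exact min_eq_left h.le
  · exact absurd h (lt_irrefl _)

theorem exists_forall_mul_rpow_le {K b s d : ℝ} (hb : 0 < b) (hsd : s < d) :
    ∃ ε > 0, ∀ r, 0 < r → r ≤ ε → K * r ^ d ≤ b * r ^ s := by
  have hlim : Tendsto (fun r : ℝ => K * r ^ (d - s)) (𝓝[>] 0) (𝓝 0) := by
    have h1 : ContinuousAt (fun r : ℝ => K * r ^ (d - s)) 0 :=
      (Real.continuousAt_rpow_const 0 (d - s) (Or.inr (by linarith))).const_mul K
    have h2 := h1.tendsto
    simp only [Real.zero_rpow (sub_pos.2 hsd).ne', mul_zero] at h2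
    exact h2.mono_left nhdsWithin_le_nhds
  obtain ⟨ε, hε, hsub⟩ := mem_nhdsGT_iff_exists_Ioc_subset.1
    (hlim.eventually (eventually_le_nhds hb))
  refine ⟨ε, hε, fun r hr hrε => ?_⟩
  have h1 : K * r ^ (d - s) ≤ b := hsub ⟨hr, hrε⟩
  calc K * r ^ d = K * r ^ (d - s) * r ^ s := by
        rw [mul_assoc, ← Real.rpow_add hr, sub_add_cancel]
    _ ≤ b * r ^ s := by gcongr

namespace LocallyUbiquitous

variable {X ι : Type*} [MetricSpace X] [MeasurableSpace X] [BorelSpace X]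
  {μ : Measure X} [IsFiniteMeasure μ] {d C : ℝ} {J : ℕ → Set ι} {c : ι → X} {ρ ψ : ℕ → ℝ}

theorem ae_frequently_mem_mul_min [SecondCountableTopology X] (hu : LocallyUbiquitous μ J c ρ)
    (h : AhlforsRegular μ d C) (hψ : ∀ i, 0 < ψ i) {s : ℝ}
    (hdiv : ¬ Summable fun i => ψ i ^ s / ρ i ^ d) {t : ℝ} (ht : 0 < t) (ht1 : t ≤ 1) :
    ∀ᵐ x ∂μ, ∃ᶠ i in atTop, x ∈ ⋃ q ∈ J i, ball (c q) (t * min (ψ i ^ (s / d)) (ρ i)) := by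
  have hd := h.dim_pos
  have hω : ∀ i, 0 < min (ψ i ^ (s / d)) (ρ i) := fun i =>
    lt_min (Real.rpow_pos_of_pos (hψ i) _) (hu.pos i)
  refine hu.ae_frequently_mem h (fun i => mul_pos ht (hω i)) (fun i => ?_) ?_
  · exact (mul_le_of_le_one_left (hω i).le ht1).trans (min_le_right _ _)
  · have heq : (fun i => (t * min (ψ i ^ (s / d)) (ρ i) / ρ i) ^ d) =
        fun i => t ^ d * min (ψ i ^ s / ρ i ^ d) 1 := by
      funext i
      have hρ := hu.pos i
      have hρd : 0 < ρ i ^ d := Real.rpow_pos_of_pos hρ _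
      have hψd : (ψ i ^ (s / d)) ^ d = ψ i ^ s := by
        rw [← Real.rpow_mul (hψ i).le, div_mul_cancel₀ _ hd.ne']
      rw [mul_div_assoc, Real.mul_rpow ht.le (div_nonneg (hω i).le hρ.le)]
      congr 1
      rw [Real.div_rpow (hω i).le hρ.le]
      rcases le_total (ψ i ^ (s / d)) (ρ i) with hle | hle
      · have : (ψ i ^ (s / d)) ^ d ≤ ρ i ^ d :=
          Real.rpow_le_rpow (Real.rpow_nonneg (hψ i).le _) hle hd.le
        rw [min_eq_left hle, hψd, min_eq_left]
        rwa [div_le_one hρd, ← hψd]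
      · have : ρ i ^ d ≤ (ψ i ^ (s / d)) ^ d := Real.rpow_le_rpow hρ.le hle hd.le
        rw [min_eq_right hle, div_self hρd.ne', min_eq_right]
        rwa [one_le_div hρd, ← hψd]
    rw [heq, summable_mul_left_iff (Real.rpow_pos_of_pos ht d).ne']
    exact not_summable_min_one hdiv

/-- The inductive step of the Cantor type construction. -/
theorem exists_frostmanOn [SecondCountableTopology X] (hu : LocallyUbiquitous μ J c ρ)
    (h : AhlforsRegular μ d C) (hψ : ∀ i, 0 < ψ i) {s A R₀ : ℝ} {m₀ : ℝ≥0∞} (hs : 0 ≤ s)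
    (hsd : s < d) (hdiv : ¬ Summable fun i => ψ i ^ s / ρ i ^ d) {ν : Measure X}
    {U : Set X} (hF : FrostmanOn μ s A R₀ m₀ ν U) (N : ℕ) :
    ∃ ν' U', FrostmanOn μ s A R₀ m₀ ν' U' ∧
      closure U' ⊆ U ∩ ⋃ i ≥ N, ⋃ q ∈ J i, ball (c q) (ψ i) := by
  have hC1 := h.one_le
  have hC : 0 < C := zero_lt_one.trans_le hC1
  have hd := h.dim_pos
  obtain ⟨M, hM⟩ := hF.exists_le_smul
  obtain ⟨a, ha, haA, r₀, hr₀, hball⟩ := hF.exists_closedBall_le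
  have hνμ : ν ≪ μ := (Measure.absolutelyContinuous_of_le hM).trans
    (Measure.smul_absolutelyContinuous)
  set b := (a + A) / 4 with hb
  have hbpos : 0 < b := by linarith
  obtain ⟨r₁, hr₁, hsmall⟩ := exists_forall_mul_rpow_le (K := M * C * 9 ^ d) hbpos hsd
  obtain ⟨δ₂, hδ₂, hδ₂R⟩ := exists_forall_mul_rpow_le (K := M * C ^ 3) (b := b / 8 ^ s)
    (by positivity) hsd
  obtain ⟨t₀, ht₀, ht₀b⟩ := exists_forall_mul_rpow_le (K := M * C ^ 3) (b := b / 2 ^ s) (s := 0)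
    (by positivity) hd
  obtain ⟨δ, hδ, hδ1, hδr, hδa⟩ : ∃ δ : ℝ, 0 < δ ∧ δ ≤ 1 ∧ 2 * δ ≤ (r₀ - R₀) / 2 ∧
      a * (1 + 2 * δ / r₁) ^ s ≤ 2 * b := by
    have hlim : ContinuousAt (fun δ : ℝ => a * (1 + 2 * δ / r₁) ^ s) 0 :=
      (ContinuousAt.rpow_const (by fun_prop) (Or.inr hs)).const_mul a
    have h1 : ∀ᶠ δ in 𝓝 (0 : ℝ), a * (1 + 2 * δ / r₁) ^ s ≤ 2 * b := by
      refine hlim.eventually (eventually_le_nhds ?_)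
      simp only [mul_zero, zero_div, add_zero, Real.one_rpow, mul_one]
      linarith
    have h2 : ∀ᶠ δ in 𝓝[>] (0 : ℝ), δ ∈ Ioc 0 (min 1 ((r₀ - R₀) / 4)) :=
      Ioc_mem_nhdsGT (lt_min zero_lt_one (by linarith))
    obtain ⟨δ, hδ1, hδ2⟩ := ((h1.filter_mono nhdsWithin_le_nhds).and h2).exists
    have := le_min_iff.1 hδ2.2
    exact ⟨δ, hδ2.1, this.1, by linarith, hδ1⟩
  set t := min t₀ 1 with ht
  have htpos : 0 < t := lt_min ht₀ zero_lt_one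
  set ω : ℕ → ℝ := fun i => min (ψ i ^ (s / d)) (ρ i) with hω
  have hωpos : ∀ i, 0 < ω i := fun i => lt_min (Real.rpow_pos_of_pos (hψ i) _) (hu.pos i)
  set R : ℕ → ℝ := fun i => t * ω i with hR
  have hRpos : ∀ i, 0 < R i := fun i => mul_pos htpos (hωpos i)
  have hRlim : Tendsto R atTop (𝓝 0) :=
    squeeze_zero (fun i => (hRpos i).le) (fun i =>
      (mul_le_of_le_one_left (hωpos i).le (min_le_right _ _)).trans (min_le_right _ _))
      hu.tendsto_zero
  obtain ⟨N', hN'⟩ := eventually_atTop.1 ((eventually_ge_atTop N).and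
    ((hRlim.eventually (eventually_le_nhds hδ)).and (hRlim.eventually (eventually_le_nhds hδ₂))))
  set p : ℕ → ℝ := fun i => min (ψ i / 2) (R i / 8) with hp
  have hppos : ∀ i, 0 < p i := fun i => lt_min (half_pos (hψ i)) (by linarith [hRpos i])
  have hbig : ∀ i ≥ N', M * C ^ 3 * R i ^ d ≤ b * p i ^ s := by
    intro i hi
    rcases min_choice (ψ i / 2) (R i / 8) with e | e
    · have h1 := ht₀b t htpos (min_le_left _ _)
      rw [Real.rpow_zero, mul_one] at h1
      have h2 : ω i ^ d ≤ ψ i ^ s := by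
        calc ω i ^ d ≤ (ψ i ^ (s / d)) ^ d :=
              Real.rpow_le_rpow (hωpos i).le (min_le_left _ _) hd.le
          _ = ψ i ^ s := by rw [← Real.rpow_mul (hψ i).le, div_mul_cancel₀ _ hd.ne']
      calc M * C ^ 3 * R i ^ d = (M * C ^ 3 * t ^ d) * ω i ^ d := by
            simp only [hR]
            rw [Real.mul_rpow htpos.le (hωpos i).le, mul_assoc _ (t ^ d)]
        _ ≤ b / 2 ^ s * ψ i ^ s := by
            have := Real.rpow_nonneg (hωpos i).le d
            gcongr
        _ = b * p i ^ s := by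
            simp only [hp]
            rw [e, Real.div_rpow (hψ i).le (by norm_num)]
            ring
    · calc M * C ^ 3 * R i ^ d ≤ b / 8 ^ s * R i ^ s := hδ₂R _ (hRpos i) (hN' i hi).2.2
        _ = b * p i ^ s := by
            simp only [hp]
            rw [e, Real.div_rpow (hRpos i).le (by norm_num)]
            ring
  set L : Set X := {x | ∃ᶠ i in atTop, x ∈ ⋃ q ∈ J i, ball (c q) (R i)} with hL
  have hLν : ν Lᶜ = 0 :=
    hνμ (hu.ae_frequently_mem_mul_min h hψ hdiv htpos (min_le_right _ _))
  have hRδ : ∀ i ≥ N', R i ≤ 1 := fun i hi => (hN' i hi).2.1.trans hδ1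
  obtain ⟨u, huT, hucount, hudisj, hucov⟩ := Vitali.exists_disjoint_covering_ae μ (U ∩ L)
    {z : ℕ × ι × X | N' ≤ z.1 ∧ z.2.1 ∈ J z.1 ∧ z.2.2 ∈ closedBall (c z.2.1) (R z.1) ∧
      closedBall (c z.2.1) (R z.1) ⊆ U} (C * 6 ^ d * C).toNNReal (fun z => 2 * R z.1)
    (fun z => z.2.2) (fun z => closedBall (c z.2.1) (R z.1))
    (fun z hz y hy => by
      rw [mem_closedBall] at hy ⊢
      have h1 := mem_closedBall'.1 hz.2.2.1
      linarith [dist_triangle y (c z.2.1) z.2.2])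
    (fun z hz => by
      have hRz := hRpos z.1
      have h1 := h.closedBall_le z.2.2 (3 * (2 * R z.1)) (by linarith)
      have h2 := h.le_ball (c z.2.1) (R z.1) hRz (hRδ _ hz.1)
      have h3 : μ.real (ball (c z.2.1) (R z.1)) ≤ μ.real (closedBall (c z.2.1) (R z.1)) :=
        measureReal_mono ball_subset_closedBall (measure_ne_top _ _)
      rw [← ofReal_measureReal, ← ofReal_measureReal (s := closedBall (c z.2.1) _)]
      change _ ≤ ENNReal.ofReal (C * 6 ^ d * C) * _
      rw [← ENNReal.ofReal_mul (by positivity)]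
      refine ENNReal.ofReal_le_ofReal (h1.trans ?_)
      calc C * (3 * (2 * R z.1)) ^ d = C * 6 ^ d * R z.1 ^ d := by
            rw [← mul_assoc, Real.mul_rpow (by norm_num) hRz.le]
            norm_num
            ring
        _ ≤ C * 6 ^ d * (C * μ.real (closedBall (c z.2.1) (R z.1))) := by
            gcongr
            exact h2.trans (by gcongr)
        _ = _ := by ring)
    (fun z _ => ⟨c z.2.1, ball_subset_interior_closedBall (mem_ball_self (hRpos z.1))⟩)
    (fun z _ => isClosed_closedBall)
    (fun x hx ε hε => by
      obtain ⟨ε', hε', hsub⟩ := nhds_basis_closedBall.mem_iff.1 (hF.isOpen.mem_nhds hx.1)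
      have hev : ∀ᶠ i in atTop, N' ≤ i ∧ R i ≤ min ε ε' / 2 :=
        (eventually_ge_atTop N').and
          (hRlim.eventually (eventually_le_nhds (half_pos (lt_min hε hε'))))
      obtain ⟨i, hi, hiN, hiR⟩ := (hx.2.and_eventually hev).exists
      simp only [mem_iUnion, exists_prop] at hi
      obtain ⟨q, hq, hxq⟩ := hi
      have h1 := min_le_left ε ε'
      have h2 := min_le_right ε ε'
      refine ⟨(i, q, x), ⟨hiN, hq, ball_subset_closedBall hxq, fun y hy => hsub ?_⟩, ?_, rfl⟩
      · have h3 := mem_ball'.1 hxq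
        have h4 : dist y (c q) ≤ R i := hy
        rw [mem_closedBall]
        linarith [dist_triangle y (c q) x]
      · change 2 * R i ≤ ε
        linarith)
  have hmass : m₀ < ∑' z : u, ν (closedBall (c z.1.2.1) (R z.1.1)) := by
    rw [← measure_biUnion hucount hudisj fun _ _ => measurableSet_closedBall]
    refine hF.lt_univ.trans_le ?_
    set B := ⋃ z ∈ u, closedBall (c z.2.1) (R z.1) with hB
    have hnull : ν Bᶜ = 0 := by
      refine measure_mono_null (t := Uᶜ ∪ Lᶜ ∪ ((U ∩ L) \ B)) ?_ ?_
      · intro x hx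
        by_cases hxU : x ∈ U
        · by_cases hxL : x ∈ L
          · exact Or.inr ⟨⟨hxU, hxL⟩, hx⟩
          · exact Or.inl (Or.inr hxL)
        · exact Or.inl (Or.inl hxU)
      · rw [measure_union_null_iff, measure_union_null_iff]
        exact ⟨⟨hF.compl_eq_zero, hLν⟩, hνμ hucov⟩
    calc ν univ = ν (B ∪ Bᶜ) := by rw [union_compl_self]
      _ ≤ ν B + ν Bᶜ := measure_union_le _ _
      _ = ν B := by rw [hnull, add_zero]
  rw [ENNReal.tsum_eq_iSup_sum, lt_iSup_iff] at hmass
  obtain ⟨F, hFm⟩ := hmass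
  have huN : ∀ z : u, N' ≤ z.1.1 := fun z => (huT z.2).1
  have hppos' : ∀ j ∈ F, 0 < p j.1.1 := fun j _ => hppos _
  refine ⟨concentrate μ ν F (fun z : u => c z.1.2.1) (fun z => R z.1.1) (fun z => p z.1.1),
    ⋃ z ∈ F, ball (c z.1.2.1) (p z.1.1), ⟨isOpen_biUnion fun _ _ => isOpen_ball,
      h.exists_concentrate_le_smul hM hppos', AhlforsRegular.concentrate_compl, ?_,
      2 * b, by linarith, by linarith, (R₀ + r₀) / 2, by linarith, fun x r hr hrr => ?_⟩, ?_⟩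
  · rwa [h.concentrate_univ hppos']
  · refine h.concentrate_closedBall_le (r₁ := r₁) hM hs hsd.le hbpos.le hδ1 hppos' (fun j _ => ?_)
      (fun j _ => (hN' _ (huN j)).2.1) ?_ (fun r hr hr1 => ?_) (fun j _ => hbig _ (huN j))
      (fun x r hr1 hrr => ?_) x hr hrr
    · linarith [min_le_right (ψ j.1.1 / 2) (R j.1.1 / 8)]
    · intro j _ k _ hjk
      exact hudisj j.2 k.2 (fun e => hjk (Subtype.ext e))
    · rw [Real.mul_rpow (by norm_num) hr.le, ← mul_assoc]
      exact hsmall r hr hr1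
    · have hr0 : 0 < r := hr₁.trans_le hr1
      refine (hball x (r + 2 * δ) (by linarith) (by linarith)).trans (ENNReal.ofReal_le_ofReal ?_)
      have h1 : r + 2 * δ ≤ (1 + 2 * δ / r₁) * r := by
        have : 2 * δ ≤ 2 * δ / r₁ * r := by
          rw [div_mul_eq_mul_div, le_div_iff₀ hr₁]
          gcongr
        linarith
      calc a * (r + 2 * δ) ^ s ≤ a * ((1 + 2 * δ / r₁) * r) ^ s := by gcongr
        _ = a * (1 + 2 * δ / r₁) ^ s * r ^ s := by
          rw [Real.mul_rpow (by positivity) hr0.le, mul_assoc]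
        _ ≤ 2 * b * r ^ s := by gcongr
  · have hcl : closure (⋃ z ∈ F, ball (c z.1.2.1) (p z.1.1)) ⊆
        ⋃ z ∈ F, closedBall (c z.1.2.1) (p z.1.1) := by
      refine closure_minimal (iUnion₂_mono fun _ _ => ball_subset_closedBall) ?_
      exact isClosed_biUnion_finset fun _ _ => isClosed_closedBall
    refine hcl.trans (iUnion₂_subset fun z _ => subset_inter ?_ ?_)
    · refine (closedBall_subset_closedBall ?_).trans (huT z.2).2.2.2
      linarith [min_le_right (ψ z.1.1 / 2) (R z.1.1 / 8), hRpos z.1.1]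
    · refine (closedBall_subset_ball (ε₂ := ψ z.1.1) ?_).trans ?_
      · linarith [min_le_left (ψ z.1.1 / 2) (R z.1.1 / 8), hψ z.1.1]
      · exact fun y hy => mem_iUnion₂.2 ⟨z.1.1, (hN' _ (huN z)).1,
          mem_iUnion₂.2 ⟨z.1.2.1, (huT z.2).2.1, hy⟩⟩

end LocallyUbiquitous

namespace FrostmanOn

variable {X : Type*} [MetricSpace X] [MeasurableSpace X] {μ : Measure X}
  {s A R₀ : ℝ} {m₀ : ℝ≥0∞} {ν : Measure X} {U : Set X}

theorem pos (h : FrostmanOn μ s A R₀ m₀ ν U) : 0 < A := by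
  obtain ⟨a, ha, haA, -⟩ := h.exists_closedBall_le
  exact ha.trans_lt haA

theorem measure_closedBall_le (h : FrostmanOn μ s A R₀ m₀ ν U) {x : X} {r : ℝ} (hr : 0 < r)
    (hrR : r ≤ R₀) : ν (closedBall x r) ≤ ENNReal.ofReal (A * r ^ s) := by
  obtain ⟨a, ha, haA, r₀, hr₀, hball⟩ := h.exists_closedBall_le
  exact (hball x r hr (hrR.trans hr₀.le)).trans (ENNReal.ofReal_le_ofReal (by gcongr))

/-- The mass distribution principle for a decreasing sequence of compact sets carrying measures
with a common Frostman type bound. -/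
theorem div_le_hausdorffMeasure_iInter [CompactSpace X] [BorelSpace X] (hs : 0 ≤ s) (hR₀ : 0 < R₀)
    {ν : ℕ → Measure X} {U : ℕ → Set X} (h : ∀ k, FrostmanOn μ s A R₀ m₀ (ν k) (U k))
    (hU : Antitone fun k => closure (U k)) :
    m₀ / ENNReal.ofReal A ≤ μH[s] (⋂ k, closure (U k)) := by
  have hA := (h 0).pos
  rw [Measure.hausdorffMeasure_apply]
  refine le_iSup₂_of_le (ENNReal.ofReal (R₀ / 2)) (ENNReal.ofReal_pos.2 (half_pos hR₀)) ?_
  refine le_iInf₂ fun t ht => le_iInf fun htd => ENNReal.div_le_of_le_mul ?_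
  refine ENNReal.le_of_forall_pos_le_add fun ε hε _ => ?_
  obtain ⟨ε', hε', hsum⟩ := ENNReal.exists_pos_sum_of_countable
    (ENNReal.coe_ne_zero.2 hε.ne') ℕ
  have key : ∀ n, ∃ V : Set X, IsOpen V ∧ t n ⊆ V ∧ ∀ k, ν k V ≤
      (⨆ _ : (t n).Nonempty, ediam (t n) ^ s) * ENNReal.ofReal A + ε' n := by
    intro n
    rcases (t n).eq_empty_or_nonempty with he | ⟨x, hx⟩
    · exact ⟨∅, isOpen_empty, he.subset, fun k => by simp⟩
    set D := (ediam (t n)).toReal with hD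
    have hDtop : ediam (t n) ≠ ∞ := ((htd n).trans_lt ENNReal.ofReal_lt_top).ne
    have hDeq : ediam (t n) = ENNReal.ofReal D := (ENNReal.ofReal_toReal hDtop).symm
    have hD0 : 0 ≤ D := ENNReal.toReal_nonneg
    have hDR : D ≤ R₀ / 2 := ENNReal.toReal_le_of_le_ofReal (half_pos hR₀).le (htd n)
    obtain ⟨η, ⟨hη, hηR⟩, hηε⟩ : ∃ η, η ∈ Ioc 0 (R₀ / 2) ∧
        A * (D + η) ^ s ≤ A * D ^ s + ε' n := by
      have hlim : ContinuousAt (fun η : ℝ => A * (D + η) ^ s) 0 :=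
        (ContinuousAt.rpow_const (by fun_prop) (Or.inr hs)).const_mul A
      have h1 : ∀ᶠ η in 𝓝 (0 : ℝ), A * (D + η) ^ s ≤ A * D ^ s + ε' n := by
        refine hlim.eventually (eventually_le_nhds ?_)
        simpa using hε' n
      have h2 : ∀ᶠ η in 𝓝[>] (0 : ℝ), η ∈ Ioc 0 (R₀ / 2) := Ioc_mem_nhdsGT (half_pos hR₀)
      exact (h2.and (h1.filter_mono nhdsWithin_le_nhds)).exists
    refine ⟨ball x (D + η), isOpen_ball, fun y hy => ?_, fun k => ?_⟩
    · have h1 : edist y x ≤ ENNReal.ofReal D := hDeq ▸ edist_le_ediam_of_mem hy hx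
      have h2 : dist y x ≤ D := by
        rw [edist_dist] at h1
        exact (ENNReal.ofReal_le_ofReal_iff hD0).1 h1
      rw [mem_ball]
      linarith
    · calc ν k (ball x (D + η)) ≤ ν k (closedBall x (D + η)) :=
            measure_mono ball_subset_closedBall
        _ ≤ ENNReal.ofReal (A * (D + η) ^ s) :=
            (h k).measure_closedBall_le (by linarith) (by linarith)
        _ ≤ ENNReal.ofReal (A * D ^ s + ε' n) := ENNReal.ofReal_le_ofReal hηε
        _ = (⨆ _ : (t n).Nonempty, ediam (t n) ^ s) * ENNReal.ofReal A + ε' n := by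
          rw [ciSup_pos ⟨x, hx⟩, hDeq, ENNReal.ofReal_rpow_of_nonneg hD0 hs,
            ENNReal.ofReal_add (by positivity) (by positivity), ENNReal.ofReal_mul hA.le,
            mul_comm, ENNReal.ofReal_coe_nnreal]
  choose V hVo htV hV using key
  obtain ⟨k, hk⟩ : ∃ k, closure (U k) ⊆ ⋃ n, V n :=
    exists_subset_nhds_of_isCompact' hU.directed_ge (fun k => isClosed_closure.isCompact)
      (fun k => isClosed_closure) fun x hx =>
        (isOpen_iUnion hVo).mem_nhds (iUnion_mono htV (ht hx))
  calc m₀ ≤ ν k univ := (h k).lt_univ.le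
    _ ≤ ν k (U k) + ν k (U k)ᶜ := by
        rw [← union_compl_self (U k)]
        exact measure_union_le _ _
    _ ≤ ν k (⋃ n, V n) := by
        rw [(h k).compl_eq_zero, add_zero]
        exact measure_mono (subset_closure.trans hk)
    _ ≤ ∑' n, ((⨆ _ : (t n).Nonempty, ediam (t n) ^ s) * ENNReal.ofReal A + ε' n) :=
        (measure_iUnion_le V).trans (ENNReal.tsum_le_tsum fun n => hV n k)
    _ ≤ _ := by
        rw [ENNReal.tsum_add, ENNReal.tsum_mul_right]
        gcongr

end FrostmanOn

/-- The Hausdorff measure of the limsup set of shrunk balls in a locally ubiquitous system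
is infinite, in dimensions smaller than the dimension of the space. -/
theorem LocallyUbiquitous.hausdorffMeasure_eq_top {X ι : Type*} [MetricSpace X] [CompactSpace X]
    [MeasurableSpace X] [BorelSpace X] {μ : Measure X} [IsFiniteMeasure μ] {d C : ℝ}
    {J : ℕ → Set ι} {c : ι → X} {ρ ψ : ℕ → ℝ} (hu : LocallyUbiquitous μ J c ρ)
    (h : AhlforsRegular μ d C) (hμ : μ ≠ 0) (hψ : ∀ i, 0 < ψ i) {s : ℝ} (hs : 0 ≤ s) (hsd : s < d)
    (hdiv : ¬ Summable fun i => ψ i ^ s / ρ i ^ d) :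
    μH[s] {x | ∃ᶠ i in atTop, x ∈ ⋃ q ∈ J i, ball (c q) (ψ i)} = ∞ := by
  have hm : μ univ ≠ 0 := Measure.measure_univ_ne_zero.2 hμ
  have key : ∀ A : ℝ, 0 < A → μ univ / 2 / ENNReal.ofReal A ≤
      μH[s] {x | ∃ᶠ i in atTop, x ∈ ⋃ q ∈ J i, ball (c q) (ψ i)} := by
    intro A hA
    obtain ⟨r₀, hr₀, hCr⟩ := exists_forall_mul_rpow_le (K := C) (half_pos hA) hsd
    have h0 : FrostmanOn μ s A (r₀ / 2) (μ univ / 2) μ univ :=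
      ⟨isOpen_univ, ⟨1, by simp⟩, by simp, ENNReal.half_lt_self hm (measure_ne_top _ _),
        A / 2, (half_pos hA).le, half_lt_self hA, r₀, half_lt_self hr₀, fun x r hr hrr => by
          rw [← ofReal_measureReal]
          exact ENNReal.ofReal_le_ofReal ((h.closedBall_le x r hr).trans (hCr r hr hrr))⟩
    choose! ν' U' hF' hsub using fun (ν : Measure X) (U : Set X)
      (hF : FrostmanOn μ s A (r₀ / 2) (μ univ / 2) ν U) (N : ℕ) =>
      hu.exists_frostmanOn h hψ hs hsd hdiv hF N
    let P : ℕ → Measure X × Set X := fun k =>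
      Nat.rec (μ, univ) (fun k p => (ν' p.1 p.2 k, U' p.1 p.2 k)) k
    have hP : ∀ k, FrostmanOn μ s A (r₀ / 2) (μ univ / 2) (P k).1 (P k).2 := by
      intro k
      induction k with
      | zero => exact h0
      | succ k ih => exact hF' _ _ ih k
    have hPs : ∀ k, closure (P (k + 1)).2 ⊆
        (P k).2 ∩ ⋃ i ≥ k, ⋃ q ∈ J i, ball (c q) (ψ i) := fun k => hsub _ _ (hP k) k
    refine (FrostmanOn.div_le_hausdorffMeasure_iInter hs (half_pos hr₀) hP
      (antitone_nat_of_succ_le fun k =>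
        (hPs k).trans (inter_subset_left.trans subset_closure))).trans (measure_mono ?_)
    intro x hx
    refine frequently_atTop.2 fun k => ?_
    obtain ⟨i, hi, hxi⟩ := mem_iUnion₂.1 (hPs k (mem_iInter.1 hx (k + 1))).2
    exact ⟨i, hi, hxi⟩
  refine ENNReal.eq_top_of_forall_nnreal_le fun b => ?_
  set v := (μ univ).toReal with hv
  have hvpos : 0 < v := ENNReal.toReal_pos hm (measure_ne_top _ _)
  have hb : (0 : ℝ) < b + 1 := by positivity
  refine le_trans ?_ (key (v / 2 / (b + 1)) (by positivity))
  rw [← ENNReal.ofReal_toReal (measure_ne_top μ univ), ← hv, ← ENNReal.ofReal_ofNat 2,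
    ← ENNReal.ofReal_div_of_pos two_pos, ← ENNReal.ofReal_div_of_pos (by positivity),
    ← ENNReal.ofReal_coe_nnreal]
  refine ENNReal.ofReal_le_ofReal ?_
  rw [div_div_cancel₀ (by positivity)]
  linarith

theorem ahlforsRegular_volume_pi_addCircle {m : ℕ} (hm : 0 < m) :
    AhlforsRegular (volume : Measure (Fin m → AddCircle (1 : ℝ))) m (2 ^ m) := by
  have hvol : ∀ (x : Fin m → AddCircle (1 : ℝ)) (r : ℝ), 0 < r →
      (volume : Measure (Fin m → AddCircle (1 : ℝ))).real (closedBall x r) =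
        min 1 (2 * r) ^ m := by
    intro x r hr
    rw [measureReal_def, closedBall_pi x hr.le, volume_pi_pi]
    simp only [AddCircle.volume_closedBall, Finset.prod_const, Finset.card_univ, Fintype.card_fin]
    rw [ENNReal.toReal_pow, ENNReal.toReal_ofReal (by positivity)]
  refine ⟨one_le_pow₀ one_le_two, by exact_mod_cast hm, fun x r hr hr1 => ?_, fun x r hr => ?_⟩
  · have h1 : r ^ m ≤ (volume : Measure (Fin m → AddCircle (1 : ℝ))).real (ball x r) := by
      have h2 := hvol x (r / 2) (half_pos hr)
      rw [mul_div_cancel₀ _ two_ne_zero, min_eq_right hr1] at h2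
      rw [← h2]
      exact measureReal_mono (closedBall_subset_ball (half_lt_self hr)) (measure_ne_top _ _)
    rw [Real.rpow_natCast]
    exact h1.trans (le_mul_of_one_le_left measureReal_nonneg (one_le_pow₀ one_le_two))
  · rw [hvol x r hr, Real.rpow_natCast, ← mul_pow]
    exact pow_le_pow_left₀ (by positivity) (min_le_right _ _) m

theorem lipschitzWith_torusProj {m : ℕ} : LipschitzWith 1 (torusProj (m := m)) := by
  refine LipschitzWith.of_dist_le_mul fun x y => ?_
  rw [NNReal.coe_one, one_mul, dist_pi_le_iff dist_nonneg]
  intro i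
  refine le_trans ?_ (dist_le_pi_dist x y i)
  rw [dist_eq_norm, Real.dist_eq]
  change ‖((x i - y i : ℝ) : AddCircle (1 : ℝ))‖ ≤ _
  exact QuotientAddGroup.norm_mk_le_norm

theorem hausdorffMeasure_eq_zero_of_volume_eq_zero {m : ℕ} {E : Set (Fin m → AddCircle (1 : ℝ))}
    (hE : volume E = 0) : μH[m] E = 0 := by
  set S : Set (Fin m → ℝ) := univ.pi fun _ => Ioc 0 (0 + 1) with hS
  have hSm : MeasurableSet S := MeasurableSet.univ_pi fun _ => measurableSet_Ioc
  have hmp : MeasurePreserving (torusProj (m := m)) (volume.restrict S) volume := by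
    have := measurePreserving_pi (fun _ : Fin m => (volume : Measure ℝ).restrict (Ioc 0 (0 + 1)))
      (fun _ : Fin m => (volume : Measure (AddCircle (1 : ℝ))))
      (fun _ => AddCircle.measurePreserving_mk 1 0)
    rwa [← Measure.restrict_pi_pi] at this
  have hnull : volume (torusProj ⁻¹' E ∩ S) = 0 := by
    rw [← Measure.restrict_apply' hSm]
    exact hmp.quasiMeasurePreserving.preimage_null hE
  have hsub : E ⊆ torusProj '' (torusProj ⁻¹' E ∩ S) := by
    intro x hx
    have hex : ∀ i, ∃ y ∈ Ioc (0 : ℝ) (0 + 1), (y : AddCircle (1 : ℝ)) = x i := fun i => by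
      have h := mem_univ (x i)
      rwa [← AddCircle.coe_image_Ioc_eq (1 : ℝ) 0] at h
    choose y hy hyx using hex
    have : torusProj y = x := funext hyx
    exact ⟨y, ⟨by rwa [mem_preimage, this], fun i _ => hy i⟩, this⟩
  refine measure_mono_null hsub (nonpos_iff_eq_zero.1 ?_)
  refine (lipschitzWith_torusProj.lipschitzOnWith.hausdorffMeasure_image_le
    (Nat.cast_nonneg m)).trans ?_
  have hH : (μH[m] : Measure (Fin m → ℝ)) = volume := by
    simpa using hausdorffMeasure_pi_real (ι := Fin m)
  simp [hH, hnull]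

theorem finite_setOf_norm_intCast_le {n : ℕ} (R : ℝ) :
    {q : Fin n → ℤ | ‖(fun j => (q j : ℝ))‖ ≤ R}.Finite := by
  refine ((isCompact_closedBall (0 : Fin n → ℤ) R).finite_of_discrete).subset fun q hq => ?_
  rw [mem_closedBall_zero_iff]
  refine le_trans (le_of_eq ?_) hq
  simp only [Pi.norm_def]
  congr

theorem locallyUbiquitous_of_deltaLU {m n : ℕ} (A : Matrix (Fin m) (Fin n) ℝ) {ρ : ℝ → ℝ}
    (hρpos : ∀ r : ℝ, 0 < r → 0 < ρ r) (hρ0 : Tendsto ρ atTop (𝓝 0)) {l u : ℕ → ℝ}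
    (hupos : ∀ i, 0 < u i) (hutop : Tendsto u atTop atTop) {κ : ℝ} (hκ : 0 < κ)
    (hub : ∀ (x : Fin m → AddCircle (1 : ℝ)) (r : ℝ), 0 < r → ∃ i₀ : ℕ, ∀ i ≥ i₀,
      ENNReal.ofReal κ * volume (ball x r) ≤ volume (ball x r ∩ DeltaLU m n A ρ l u i))
    {lam : ℝ} (hlam0 : 0 ≤ lam) (hlam1 : lam < 1)
    (hreg : ∃ i₀ : ℕ, ∀ i ≥ i₀, ρ (u (i + 1)) ≤ lam * ρ (u i)) :
    LocallyUbiquitous (volume : Measure (Fin m → AddCircle (1 : ℝ)))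
      (fun i => {q : Fin n → ℤ | l i < ‖(fun j => (q j : ℝ))‖ ∧ ‖(fun j => (q j : ℝ))‖ ≤ u i})
      (fun q => torusProj (A.mulVec fun j => (q j : ℝ))) (fun i => ρ (u i)) where
  finite i := (finite_setOf_norm_intCast_le (u i)).subset fun _ hq => hq.2
  pos i := hρpos _ (hupos i)
  tendsto_zero := hρ0.comp hutop
  exists_le_measureReal := by
    refine ⟨κ, hκ, fun x r hr => eventually_atTop.2 ?_⟩
    obtain ⟨i₀, hi₀⟩ := hub x r hr
    refine ⟨i₀, fun i hi => ?_⟩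
    have h := ENNReal.toReal_mono (measure_ne_top _ _) (hi₀ i hi)
    rwa [ENNReal.toReal_mul, ENNReal.toReal_ofReal hκ.le] at h
  exists_le_mul := ⟨lam, hlam0, hlam1, eventually_atTop.2 hreg⟩

theorem setOf_frequently_subset_WAT {m n : ℕ} (A : Matrix (Fin m) (Fin n) ℝ) {ψ : ℝ → ℝ}
    (hψdec : ∀ x y : ℝ, 0 < x → x ≤ y → ψ y ≤ ψ x) {l u : ℕ → ℝ} (hlpos : ∀ i, 0 < l i)
    (hltop : Tendsto l atTop atTop) :
    {x | ∃ᶠ i in atTop, x ∈ ⋃ q ∈ {q : Fin n → ℤ | l i < ‖(fun j => (q j : ℝ))‖ ∧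
      ‖(fun j => (q j : ℝ))‖ ≤ u i}, ball (torusProj (A.mulVec fun j => (q j : ℝ))) (ψ (u i))} ⊆
      WAT m n A ψ := by
  intro x hx hfin
  obtain ⟨b, hb⟩ := (hfin.image fun q : Fin n → ℤ => ‖(fun j => (q j : ℝ))‖).bddAbove
  obtain ⟨i, hi, hbi⟩ := (hx.and_eventually (hltop.eventually_ge_atTop b)).exists
  obtain ⟨q, ⟨hlq, hqu⟩, hxq⟩ := mem_iUnion₂.1 hi
  refine absurd (hb ⟨q, ?_, rfl⟩) (not_le.2 (hbi.trans_lt hlq))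
  exact (mem_ball'.1 hxq).trans_le (hψdec _ _ ((hlpos i).trans hlq) hqu)

end MetricMeasure

/-- Ubiquity theorem in the inhomogeneous setup: local ubiquity plus `u`-regularity
of `ρ` imply that divergence of `∑ ψ(u_i)^s / ρ(u_i)^m` gives full `ℋ^s` measure. -/
theorem ubiquity (m n : ℕ) (hm : 0 < m) (hn : 0 < n)
    (A : Matrix (Fin m) (Fin n) ℝ)
    (ψ : ℝ → ℝ) (hψpos : ∀ r : ℝ, 0 < r → 0 < ψ r)
    (hψdec : ∀ x y : ℝ, 0 < x → x ≤ y → ψ y ≤ ψ x)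
    (ρ : ℝ → ℝ) (hρpos : ∀ r : ℝ, 0 < r → 0 < ρ r)
    (hρ0 : Tendsto ρ atTop (nhds 0))
    (l u : ℕ → ℝ) (hlpos : ∀ i, 0 < l i) (hlmono : Monotone l) (humono : Monotone u)
    (hlu : ∀ i, l i < u i) (hltop : Tendsto l atTop atTop)
    -- local ubiquity
    (κ : ℝ) (hκ : 0 < κ)
    (hub : ∀ (x : Fin m → AddCircle (1 : ℝ)) (r : ℝ), 0 < r → ∃ i₀ : ℕ, ∀ i ≥ i₀,
      ENNReal.ofReal κ * volume (Metric.ball x r) ≤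
        volume (Metric.ball x r ∩ DeltaLU m n A ρ l u i))
    -- u-regularity of ρ
    (lam : ℝ) (hlam0 : 0 < lam) (hlam1 : lam < 1)
    (hreg : ∃ i₀ : ℕ, ∀ i ≥ i₀, ρ (u (i + 1)) ≤ lam * ρ (u i))
    (s : ℝ) (hs0 : 0 ≤ s) (hsm : s ≤ m)
    (hdiv : ¬ Summable (fun i : ℕ => ψ (u i) ^ s / ρ (u i) ^ m)) :
    μH[s] (WAT m n A ψ) = μH[s] (Set.univ : Set (Fin m → AddCircle (1 : ℝ))) := by
  have hmR : (0 : ℝ) < m := by exact_mod_cast hm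
  have hAR := ahlforsRegular_volume_pi_addCircle hm
  have hupos : ∀ i, 0 < u i := fun i => (hlpos i).trans (hlu i)
  have hutop : Tendsto u atTop atTop := tendsto_atTop_mono (fun i => (hlu i).le) hltop
  have hLU := locallyUbiquitous_of_deltaLU A hρpos hρ0 hupos hutop hκ hub hlam0.le hlam1 hreg
  have hdiv' : ¬ Summable fun i => ψ (u i) ^ s / ρ (u i) ^ (m : ℝ) := by
    simpa only [Real.rpow_natCast] using hdiv
  have hψu : ∀ i, 0 < ψ (u i) := fun i => hψpos _ (hupos i)
  have hsub := setOf_frequently_subset_WAT A hψdec hlpos hltop (u := u)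
  rcases hsm.lt_or_eq with hlt | rfl
  · have htop := hLU.hausdorffMeasure_eq_top hAR (NeZero.ne volume) hψu hs0 hlt hdiv'
    rw [measure_mono_top hsub htop, measure_mono_top (Set.subset_univ _) htop]
  · refine measure_congr (ae_eq_univ.2 (hausdorffMeasure_eq_zero_of_volume_eq_zero ?_))
    have hae := hLU.ae_frequently_mem_mul_min hAR hψu hdiv' one_pos le_rfl
    refine mem_ae_iff.1 (hae.mono fun x hx => hsub (hx.mono fun i hi => ?_))
    refine Set.iUnion₂_mono (fun q _ => Metric.ball_subset_ball ?_) hi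
    rw [one_mul, div_self hmR.ne', Real.rpow_one]
    exact min_le_left _ _
end

section
/- Let m, n be positive integers, A ∈ M_{m,n}(ℝ), ε > 0, and let ℓ be a positive integer such that there is no q ∈ ℤ^n with ‖Aq‖_ℤ < ε 2^{−nℓ/m} and 0 < ‖q‖ < 2^ℓ (i.e., ℓ ∈ L(ε)). Then for any b ∈ ℝ^m there exists q ∈ ℤ^n such that ‖Aq − b‖_ℤ ≤ (1/2)(ε^{−m}+1) ε 2^{−nℓ/m} and ‖q‖ ≤ (1/2)(ε^{−m}+1) 2^ℓ. -/
open MeasureTheory Filter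

/-- Distance from `x ∈ ℝ^k` to the nearest integer vector, in the sup norm. -/
noncomputable def intDist {k : ℕ} (x : Fin k → ℝ) : ℝ :=
  ⨅ p : Fin k → ℤ, ‖x - (fun i => (p i : ℝ))‖

/-- The coordinatewise inclusion of `ℤ^ι` into `ℝ^ι`. -/
def intVec (ι : Type*) : (ι → ℤ) →+ (ι → ℝ) := (Int.castAddHom ℝ).compLeft ι

@[simp]
lemma intVec_apply {ι : Type*} (z : ι → ℤ) (i : ι) : intVec ι z i = z i := rfl

/-- Integral lines in the torus `ℝ^N / ℤ^N` can be made arbitrarily dense. -/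
lemma exists_int_line_dense (N : ℕ) {δ : ℝ} (hδ : 0 < δ) :
    ∃ b : Fin N → ℤ, ∀ t : Fin N → ℝ, ∃ s : ℝ, ∃ z : Fin N → ℤ,
      ∀ i, |s * b i - t i - z i| ≤ δ := by
  induction N with
  | zero => exact ⟨0, fun t => ⟨0, 0, fun i => i.elim0⟩⟩
  | succ N ih =>
    obtain ⟨b, hb⟩ := ih
    obtain ⟨P, hP⟩ := exists_nat_one_div_lt hδ
    have hQ : (0 : ℝ) < P + 1 := by positivity
    refine ⟨Fin.cons 1 fun i => (P + 1) * b i, fun t => ?_⟩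
    obtain ⟨s, z, hz⟩ := hb (fun i => t i.succ)
    set k : ℤ := ⌊(P + 1) * t 0⌋ with hk
    refine ⟨(k + Int.fract s) / (P + 1),
      Fin.cons 0 fun i => z i + (k - ⌊s⌋) * b i, fun i => ?_⟩
    refine Fin.cases ?_ (fun i => ?_) i
    · have h1 : (k : ℝ) ≤ (P + 1) * t 0 := Int.floor_le _
      have h2 : (P + 1) * t 0 < k + 1 := Int.lt_floor_add_one _
      have h3 := Int.fract_nonneg s
      have h4 := Int.fract_lt_one s
      simp only [Fin.cons_zero, Int.cast_one, mul_one, Int.cast_zero, sub_zero]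
      refine le_trans ?_ hP.le
      have : (k + Int.fract s) / (P + 1) - t 0 = (k + Int.fract s - (P + 1) * t 0) / (P + 1) := by
        field_simp
      rw [this, abs_div, abs_of_pos hQ]
      gcongr
      rw [abs_le]
      constructor <;> linarith
    · simp only [Fin.cons_succ]
      convert hz i using 2
      push_cast
      have h5 := Int.floor_add_fract s
      have : Int.fract s = s - ⌊s⌋ := by linarith
      rw [this]
      field_simp
      ring

/-- Cyclic subgroups of large prime order can be made arbitrarily dense in `ℝ^ι / ℤ^ι`. -/
lemma exists_prime_cyclic_dense {ι : Type*} [Fintype ι] {δ : ℝ} (hδ : 0 < δ) (p₀ : ℕ) :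
    ∃ p : ℕ, p.Prime ∧ p₀ ≤ p ∧ ∃ b : ι → ℤ, ∀ t : ι → ℝ, ∃ j : ZMod p, ∃ z : ι → ℤ,
      ‖((j.val : ℝ) / p) • intVec ι b - t - intVec ι z‖ ≤ δ := by
  obtain ⟨b, hb⟩ := exists_int_line_dense (Fintype.card ι) (half_pos hδ)
  let e := Fintype.equivFin ι
  obtain ⟨p, hp, hprime⟩ :=
    Nat.exists_infinite_primes (max p₀ ⌈‖intVec _ b‖ / δ⌉₊)
  have hp0 : (0 : ℝ) < p := by exact_mod_cast hprime.pos
  have hpB : ‖intVec _ b‖ ≤ p * δ := by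
    rw [← div_le_iff₀ hδ]
    exact (Nat.le_ceil _).trans (by exact_mod_cast (le_max_right _ _).trans hp)
  refine ⟨p, hprime, (le_max_left _ _).trans hp, fun i => b (e i), fun t => ?_⟩
  obtain ⟨s, z, hz⟩ := hb (fun i => t (e.symm i))
  set r : ℤ := round (p * s) with hr
  have : NeZero p := ⟨hprime.ne_zero⟩
  refine ⟨(r : ZMod p), fun i => z (e i) - (r / p) * b (e i), ?_⟩
  rw [pi_norm_le_iff_of_nonneg hδ.le]
  intro i
  have hval : (((r : ZMod p).val : ℕ) : ℝ) = r - p * (r / (p : ℤ) : ℤ) := by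
    have h1 : (((r : ZMod p).val : ℕ) : ℤ) = r - p * (r / (p : ℤ)) := by
      rw [ZMod.val_intCast, Int.emod_def]
    exact_mod_cast congrArg (Int.cast : ℤ → ℝ) h1
  have hbi : |(b (e i) : ℝ)| ≤ p * δ := (norm_le_pi_norm (intVec _ b) (e i)).trans hpB
  have hround : |s - r / p| ≤ 1 / (2 * p) := by
    have h1 := abs_sub_round (p * s)
    have h2 : s - r / p = (p * s - r) / p := by field_simp
    rw [h2, abs_div, abs_of_pos hp0, div_le_div_iff₀ hp0 (by positivity)]
    nlinarith
  have hprod : |(s - r / p) * b (e i)| ≤ δ / 2 := by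
    rw [abs_mul]
    calc |s - r / p| * |(b (e i) : ℝ)| ≤ 1 / (2 * p) * (p * δ) := by gcongr
      _ = δ / 2 := by field_simp
  have hzi := hz (e i)
  simp only [Equiv.symm_apply_apply] at hzi
  simp only [Pi.sub_apply, Pi.smul_apply, intVec_apply, smul_eq_mul, Real.norm_eq_abs, hval]
  push_cast
  have : (r - p * ((r / (p : ℤ) : ℤ) : ℝ)) / p * b (e i) - t i
        - (z (e i) - ((r / (p : ℤ) : ℤ) : ℝ) * b (e i))
      = (s * b (e i) - t i - z (e i)) - (s - r / p) * b (e i) := by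
    field_simp
    ring
  rw [this]
  exact (abs_sub _ _).trans (by linarith)

open Pointwise in
/-- If `f` maps no nonzero integer vector into the open unit ball, then some translate of the
preimage of the ball of radius `1/2` meets a finite family of points of the torus at least as often
as its volume predicts. -/
lemma exists_translate_card_le {ι J : Type*} [Fintype ι] (f : (ι → ℝ) →L[ℝ] (ι → ℝ))
    (hdet : LinearMap.det (f : (ι → ℝ) →ₗ[ℝ] (ι → ℝ)) ≠ 0)
    (hf : ∀ z : ι → ℤ, z ≠ 0 → 1 ≤ ‖f (intVec ι z)‖) (s : Finset J) (x : J → ι → ℝ) :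
    ∃ v : ι → ℝ, ∃ a ⊆ s, (∀ j ∈ a, ∃ z : ι → ℤ, ‖f (x j - v - intVec ι z)‖ < 1 / 2) ∧
      (s.card : ℝ) * |LinearMap.det (f : (ι → ℝ) →ₗ[ℝ] (ι → ℝ))|⁻¹ ≤ a.card := by
  classical
  let b := Pi.basisFun ℝ ι
  let Λ := (Submodule.span ℤ (Set.range b)).toAddSubgroup
  let D := ZSpan.fundamentalDomain b
  have hΛ : ∀ y : ι → ℝ, y ∈ Λ ↔ ∃ z : ι → ℤ, intVec ι z = y := by
    intro y
    rw [Submodule.mem_toAddSubgroup, Module.Basis.mem_span_iff_repr_mem]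
    constructor
    · intro h
      choose z hz using h
      exact ⟨z, funext fun i => by simpa [b] using hz i⟩
    · rintro ⟨z, rfl⟩ i
      exact ⟨z i, by simp [b]⟩
  have hfund : IsAddFundamentalDomain Λ D (volume : Measure (ι → ℝ)) :=
    ZSpan.isAddFundamentalDomain' b volume
  have hDvol : (volume : Measure (ι → ℝ)) D = 1 := by
    have h1 : Matrix.of b = (1 : Matrix ι ι ℝ) := by
      ext i j
      simp [b, Pi.single_apply, Matrix.one_apply, eq_comm]
    simp [D, ZSpan.volume_fundamentalDomain, h1]
  have hDmeas : MeasurableSet D := ZSpan.fundamentalDomain_measurableSet b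
  let T : J → Set (ι → ℝ) := fun j => {v | ‖f (x j - v)‖ < 1 / 2}
  have hTopen : ∀ j, IsOpen (T j) := fun j => isOpen_lt (by fun_prop) continuous_const
  set V := ENNReal.ofReal |(LinearMap.det (f : (ι → ℝ) →ₗ[ℝ] (ι → ℝ)))⁻¹| with hV
  have hTvol : ∀ j, volume (T j) = V := by
    intro j
    have h1 : T j = (f : (ι → ℝ) →ₗ[ℝ] (ι → ℝ)) ⁻¹' Metric.ball (f (x j)) (1 / 2) := by
      ext v
      simp [T, dist_eq_norm, norm_sub_rev]
    rw [h1, Measure.addHaar_preimage_linearMap _ hdet, Real.volume_pi_ball _ (by norm_num)]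
    simp [hV]
  have : Countable Λ := by
    have h1 : (Λ : Set (ι → ℝ)) = Set.range (intVec ι) := Set.ext hΛ
    exact (h1 ▸ Set.countable_range (intVec ι) : (Λ : Set (ι → ℝ)).Countable).to_subtype
  let U : J → Set (ι → ℝ) := fun j => ⋃ g : Λ, g +ᵥ T j
  have hUmeas : ∀ j, MeasurableSet (U j) := fun j =>
    (isOpen_iUnion fun g : Λ => (hTopen j).vadd g).measurableSet
  have hUvol : ∀ j, (volume : Measure (ι → ℝ)).restrict D (U j) = V := by
    intro j
    rw [Measure.restrict_apply (hUmeas j), Set.iUnion_inter, measure_iUnion]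
    · rw [← hTvol j, hfund.measure_eq_tsum]
    · intro g g' hgg'
      refine Set.disjoint_left.2 ?_
      rintro y ⟨hy, -⟩ ⟨hy', -⟩
      obtain ⟨u, hu, rfl⟩ := hy
      obtain ⟨w, hw, hwu⟩ := hy'
      obtain ⟨z, hz⟩ := (hΛ _).1 (g - g').2
      have hz0 : z ≠ 0 := by
        rintro rfl
        rw [map_zero] at hz
        exact hgg' (sub_eq_zero.1 (Subtype.ext hz.symm))
      have h2 : intVec ι z = (x j - u) - (x j - w) := by
        have h3 : (g' : ι → ℝ) + w = g + u := hwu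
        rw [hz, AddSubgroupClass.coe_sub]
        linear_combination -h3
      have h4 := hf z hz0
      rw [h2, map_sub] at h4
      have h5 := norm_sub_le (f (x j - u)) (f (x j - w))
      have h6 : ‖f (x j - u)‖ < 1 / 2 := hu
      have h7 : ‖f (x j - w)‖ < 1 / 2 := hw
      linarith
    · exact fun g => (((hTopen j).vadd g).measurableSet).inter hDmeas
  have hprob : IsProbabilityMeasure ((volume : Measure (ι → ℝ)).restrict D) :=
    ⟨by rw [Measure.restrict_apply_univ, hDvol]⟩
  have hint : ∫⁻ v in D, ∑ j ∈ s, (U j).indicator 1 v = s.card * V := by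
    rw [lintegral_finsetSum _ fun j _ => measurable_one.indicator (hUmeas j)]
    simp_rw [lintegral_indicator_one (hUmeas _), hUvol]
    simp
  obtain ⟨v, hv⟩ := exists_lintegral_le (μ := (volume : Measure (ι → ℝ)).restrict D)
    (f := fun v => ∑ j ∈ s, (U j).indicator 1 v)
    (by rw [hint]; exact ENNReal.mul_ne_top (by simp) (by simp [hV]))
  rw [hint] at hv
  refine ⟨v, s.filter fun j => v ∈ U j, Finset.filter_subset _ _, fun j hj => ?_, ?_⟩
  · obtain ⟨g, u, hu, huv⟩ := Set.mem_iUnion.1 (Finset.mem_filter.1 hj).2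
    obtain ⟨z, hz⟩ := (hΛ _).1 g.2
    refine ⟨-z, ?_⟩
    have h1 : (g : ι → ℝ) + u = v := huv
    have h2 : x j - v - intVec ι (-z) = x j - u := by
      rw [map_neg, hz, ← h1]; abel
    rw [h2]
    exact hu
  · have h1 : ∑ j ∈ s, (U j).indicator (1 : (ι → ℝ) → ENNReal) v
        = ((s.filter fun j => v ∈ U j).card : ENNReal) := by
      simp [Set.indicator_apply, Finset.sum_boole]
    rw [h1] at hv
    have h2 := ENNReal.toReal_mono (by simp) hv
    simpa [hV, abs_inv] using h2

open Pointwise in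
/-- Repeated sums of a subset of `ZMod p`, tracked through the associated points of the torus. -/
lemma exists_finset_card_of_sum {ι : Type*} [Fintype ι] {p : ℕ} (hp : p.Prime)
    (f : (ι → ℝ) →L[ℝ] (ι → ℝ)) (b : ι → ℤ) (v : ι → ℝ) (a : Finset (ZMod p)) (c : ℕ)
    (hc : c + 1 ≤ a.card)
    (ha : ∀ j ∈ a, ∃ z : ι → ℤ,
      ‖f (((j.val : ℝ) / p) • intVec ι b - v - intVec ι z)‖ < 1 / 2) (k : ℕ) :
    ∃ s : Finset (ZMod p), min p (k * c + 1) ≤ s.card ∧ ∀ j ∈ s, ∃ z : ι → ℤ,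
      ‖f (((j.val : ℝ) / p) • intVec ι b - (k : ℝ) • v - intVec ι z)‖ ≤ k / 2 := by
  have : NeZero p := ⟨hp.ne_zero⟩
  have hp0 : (p : ℝ) ≠ 0 := by exact_mod_cast hp.ne_zero
  induction k with
  | zero =>
    refine ⟨{0}, by simp, fun j hj => ⟨0, ?_⟩⟩
    rw [Finset.mem_singleton.1 hj]
    simp
  | succ k ih =>
    obtain ⟨s, hs, hsz⟩ := ih
    have hs0 : 1 ≤ s.card := le_trans (le_min hp.one_le (by omega)) hs
    refine ⟨s + a, ?_, fun j hj => ?_⟩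
    · have h1 := ZMod.cauchy_davenport hp (s := s) (t := a) (Finset.card_pos.1 (by omega))
        (Finset.card_pos.1 (by omega))
      have h2 : (k + 1) * c + 1 = (k * c + 1) + (c + 1) - 1 := by
        rw [add_mul, one_mul]; omega
      rw [h2]
      omega
    · obtain ⟨i, hi, l, hl, rfl⟩ := Finset.mem_add.1 hj
      obtain ⟨z, hz⟩ := hsz i hi
      obtain ⟨w, hw⟩ := ha l hl
      obtain ⟨d, hd⟩ : ∃ d : ℤ, ((i + l).val : ℝ) = i.val + l.val - p * d := by
        refine ⟨((i.val + l.val) / p : ℕ), ?_⟩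
        have h3 := Nat.mod_add_div (i.val + l.val) p
        rw [ZMod.val_add, eq_sub_iff_add_eq]
        have h4 := congrArg (Nat.cast : ℕ → ℝ) h3
        rwa [Nat.cast_add, Nat.cast_add, Nat.cast_mul] at h4
      refine ⟨z + w - d • b, ?_⟩
      have h4 : (((i + l).val : ℝ) / p) • intVec ι b - ((k + 1 : ℕ) : ℝ) • v
            - intVec ι (z + w - d • b)
          = (((i.val : ℝ) / p) • intVec ι b - (k : ℝ) • v - intVec ι z)
            + (((l.val : ℝ) / p) • intVec ι b - v - intVec ι w) := by
        ext t
        simp only [hd, Pi.sub_apply, Pi.add_apply, Pi.smul_apply, intVec_apply, smul_eq_mul]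
        push_cast
        field_simp
        ring
      rw [h4, map_add]
      refine (norm_add_le _ _).trans ?_
      push_cast
      linarith

/-- If the linear map `f` sends no nonzero integer vector into the open unit ball, then every point
is moved by `f` to within `h / 2` of an image of an integer vector, for any integer
`h > |det f|`. -/
theorem exists_intVec_norm_map_sub_le {ι : Type*} [Fintype ι] (f : (ι → ℝ) →L[ℝ] (ι → ℝ))
    (hdet : LinearMap.det (f : (ι → ℝ) →ₗ[ℝ] (ι → ℝ)) ≠ 0)
    (hf : ∀ z : ι → ℤ, z ≠ 0 → 1 ≤ ‖f (intVec ι z)‖) (h : ℕ)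
    (hh : |LinearMap.det (f : (ι → ℝ) →ₗ[ℝ] (ι → ℝ))| < h) (t : ι → ℝ) :
    ∃ z : ι → ℤ, ‖f (t - intVec ι z)‖ ≤ h / 2 := by
  have happrox : ∀ η > 0, ∃ z : ι → ℤ, ‖f (t - intVec ι z)‖ ≤ h / 2 + η := by
    intro η hη
    set Δ := |LinearMap.det (f : (ι → ℝ) →ₗ[ℝ] (ι → ℝ))| with hΔ
    have hΔ0 : 0 < Δ := abs_pos.2 hdet
    have hgap : 0 < (h : ℝ) * Δ⁻¹ - 1 := by
      rw [sub_pos, ← div_eq_mul_inv, one_lt_div hΔ0]; exact hh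
    obtain ⟨p₀, hp₀⟩ := exists_nat_ge ((h : ℝ) / (h * Δ⁻¹ - 1))
    obtain ⟨p, hp, hp₀p, b, hb⟩ := exists_prime_cyclic_dense (ι := ι)
      (δ := η / (‖f‖ + 1)) (by positivity) p₀
    have : NeZero p := ⟨hp.ne_zero⟩
    have hpR : (0 : ℝ) < p := by exact_mod_cast hp.pos
    obtain ⟨v, a, -, ha, hcard⟩ := exists_translate_card_le f hdet hf
      (Finset.univ : Finset (ZMod p)) (fun j => ((j.val : ℝ) / p) • intVec ι b)
    rw [Finset.card_univ, ZMod.card, ← hΔ] at hcard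
    have ha0 : 0 < a.card := by
      have : (0 : ℝ) < a.card := lt_of_lt_of_le (by positivity) hcard
      exact_mod_cast this
    obtain ⟨c, hc⟩ : ∃ c, a.card = c + 1 := ⟨a.card - 1, by omega⟩
    have hcp : p ≤ h * c + 1 := by
      have h1 : (h : ℝ) ≤ p * (h * Δ⁻¹ - 1) := by
        rw [← div_le_iff₀ hgap]
        exact hp₀.trans (by exact_mod_cast hp₀p)
      rw [hc] at hcard
      push_cast at hcard
      have h2 : (h : ℝ) * (p * Δ⁻¹) ≤ h * (c + 1) := by gcongr
      have h3 : (p : ℝ) ≤ h * c + 1 := by linarith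
      exact_mod_cast h3
    obtain ⟨s, hs, hsz⟩ := exists_finset_card_of_sum hp f b v a c hc.ge ha h
    have hsuniv : s = Finset.univ := by
      rw [← Finset.card_eq_iff_eq_univ, ZMod.card]
      refine le_antisymm ((Finset.card_le_univ s).trans_eq (ZMod.card p)) ?_
      rwa [min_eq_left hcp] at hs
    obtain ⟨j, w, hw⟩ := hb (t + (h : ℝ) • v)
    obtain ⟨z, hz⟩ := hsz j (hsuniv ▸ Finset.mem_univ j)
    refine ⟨z - w, ?_⟩
    have h4 : t - intVec ι (z - w)
        = (((j.val : ℝ) / p) • intVec ι b - (h : ℝ) • v - intVec ι z)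
          - (((j.val : ℝ) / p) • intVec ι b - (t + (h : ℝ) • v) - intVec ι w) := by
      rw [map_sub]; abel
    rw [h4, map_sub]
    refine (norm_sub_le _ _).trans (add_le_add hz ?_)
    calc _ ≤ ‖f‖ * (η / (‖f‖ + 1)) := f.le_opNorm_of_le hw
      _ ≤ (‖f‖ + 1) * (η / (‖f‖ + 1)) := by gcongr; linarith
      _ = η := by field_simp
  have hker : LinearMap.ker (f : (ι → ℝ) →ₗ[ℝ] (ι → ℝ)) = ⊥ := by
    by_contra hne
    exact hdet (LinearMap.det_eq_zero_iff_ker_ne_bot.2 hne)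
  have hclosed : IsClosed (Set.range fun z : ι → ℤ => f (intVec ι z)) :=
    ((LinearMap.isClosedEmbedding_of_injective hker).comp
      (Topology.IsClosedEmbedding.piMap fun _ : ι => Int.isClosedEmbedding_coe_real)).isClosed_range
  obtain ⟨_, ⟨z, rfl⟩, hz⟩ := hclosed.exists_infDist_eq_dist (Set.range_nonempty _) (f t)
  refine ⟨z, le_of_forall_pos_le_add fun η hη => ?_⟩
  obtain ⟨w, hw⟩ := happrox η hη
  rw [map_sub, ← dist_eq_norm] at hw ⊢
  rw [← hz]
  exact (Metric.infDist_le_dist_of_mem (Set.mem_range_self w)).trans hw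

lemma intDist_le {k : ℕ} (x : Fin k → ℝ) (p : Fin k → ℤ) :
    intDist x ≤ ‖x - (fun i => (p i : ℝ))‖ :=
  ciInf_le ⟨0, by rintro _ ⟨q, rfl⟩; exact norm_nonneg _⟩ p

/-- If `ℓ ∈ L(ε)`, i.e. there is no `q ∈ ℤ^n` with `‖Aq‖_ℤ < ε 2^{-nℓ/m}` and
`0 < ‖q‖ < 2^ℓ`, then for any `b ∈ ℝ^m` there is `q ∈ ℤ^n` with
`‖Aq - b‖_ℤ ≤ (1/2)(ε^{-m}+1) ε 2^{-nℓ/m}` and `‖q‖ ≤ (1/2)(ε^{-m}+1) 2^ℓ`. -/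
theorem transference_return (m n : ℕ) (hm : 0 < m) (hn : 0 < n)
    (A : Matrix (Fin m) (Fin n) ℝ) (ε : ℝ) (hε : 0 < ε) (ℓ : ℕ) (hℓ : 1 ≤ ℓ)
    (hno : ¬ ∃ q : Fin n → ℤ,
      intDist (A.mulVec (fun j => (q j : ℝ))) < ε * (2 : ℝ) ^ (-(n : ℝ) * ℓ / m) ∧
      0 < ‖(fun j => (q j : ℝ))‖ ∧ ‖(fun j => (q j : ℝ))‖ < 2 ^ ℓ) :
    ∀ b : Fin m → ℝ, ∃ q : Fin n → ℤ,
      intDist (A.mulVec (fun j => (q j : ℝ)) - b) ≤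
        (1 / 2) * (ε ^ (-(m : ℤ)) + 1) * ε * (2 : ℝ) ^ (-(n : ℝ) * ℓ / m) ∧
      ‖(fun j => (q j : ℝ))‖ ≤ (1 / 2) * (ε ^ (-(m : ℤ)) + 1) * 2 ^ ℓ := by
  intro b
  set c : ℝ := ε * (2 : ℝ) ^ (-(n : ℝ) * ℓ / m) with hc
  have hc0 : 0 < c := by positivity
  set R : ℝ := 2 ^ ℓ with hR
  have hR0 : 0 < R := by positivity
  have hR1 : 1 < R := one_lt_pow₀ (by norm_num) (by omega)
  have hc1 : c ≤ 1 := by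
    by_contra! hlt
    let q : Fin n → ℤ := fun _ => 1
    have hq : ‖(fun j => (q j : ℝ))‖ = 1 := by
      have : Nonempty (Fin n) := ⟨⟨0, hn⟩⟩
      simp [q]
    refine hno ⟨q, ?_, by rw [hq]; norm_num, by rwa [hq]⟩
    refine (intDist_le _ fun i => round (A.mulVec (fun j => (q j : ℝ)) i)).trans_lt
      (lt_of_le_of_lt ?_ hlt)
    rw [pi_norm_le_iff_of_nonneg zero_le_one]
    intro i
    exact (abs_sub_round _).trans (by norm_num)
  let M : Matrix (Fin m ⊕ Fin n) (Fin m ⊕ Fin n) ℝ :=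
    Matrix.fromBlocks (c⁻¹ • 1) (c⁻¹ • A) 0 (R⁻¹ • 1)
  let f : (Fin m ⊕ Fin n → ℝ) →L[ℝ] (Fin m ⊕ Fin n → ℝ) :=
    LinearMap.toContinuousLinearMap M.toLin'
  have hfl : ∀ x i, f x (Sum.inl i) =
      c⁻¹ * (x (Sum.inl i) + A.mulVec (fun j => x (Sum.inr j)) i) := by
    intro x i
    simp [f, M, Matrix.fromBlocks_mulVec, Matrix.smul_mulVec, Function.comp_def, mul_add]
  have hfr : ∀ x i, f x (Sum.inr i) = R⁻¹ * x (Sum.inr i) := by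
    intro x i
    simp [f, M, Matrix.fromBlocks_mulVec, Matrix.smul_mulVec]
  have hdet : LinearMap.det (f : (Fin m ⊕ Fin n → ℝ) →ₗ[ℝ] (Fin m ⊕ Fin n → ℝ))
      = ε ^ (-(m : ℤ)) := by
    have h1 : LinearMap.det (f : (Fin m ⊕ Fin n → ℝ) →ₗ[ℝ] (Fin m ⊕ Fin n → ℝ)) = M.det := by
      simp [f]
    have h2 : ((2 : ℝ) ^ (-(n : ℝ) * ℓ / m)) ^ m = (R ^ n)⁻¹ := by
      rw [← Real.rpow_natCast, ← Real.rpow_mul (by norm_num), div_mul_cancel₀ _ (by positivity),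
        neg_mul, Real.rpow_neg (by norm_num), hR, ← pow_mul, mul_comm ℓ n]
      norm_cast
    rw [h1, Matrix.det_fromBlocks_zero₂₁, Matrix.det_smul, Matrix.det_smul]
    simp only [Fintype.card_fin, Matrix.det_one, mul_one, inv_pow, hc, mul_pow, h2, mul_inv,
      zpow_neg, zpow_natCast, inv_inv]
    field_simp
  have hΔ0 : 0 < ε ^ (-(m : ℤ)) := by positivity
  have hf : ∀ z : Fin m ⊕ Fin n → ℤ, z ≠ 0 → 1 ≤ ‖f (intVec _ z)‖ := by
    intro z hz
    by_contra! hlt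
    rw [pi_norm_lt_iff zero_lt_one] at hlt
    have hl : ∀ i, |(z (Sum.inl i) : ℝ) + A.mulVec (fun j => (z (Sum.inr j) : ℝ)) i| < c := by
      intro i
      have h1 := hlt (Sum.inl i)
      rw [hfl, Real.norm_eq_abs, abs_mul, abs_of_pos (inv_pos.2 hc0), inv_mul_lt_iff₀ hc0,
        mul_one] at h1
      exact h1
    have hr : ∀ j, |(z (Sum.inr j) : ℝ)| < R := by
      intro j
      have h1 := hlt (Sum.inr j)
      rw [hfr, Real.norm_eq_abs, abs_mul, abs_of_pos (inv_pos.2 hR0), inv_mul_lt_iff₀ hR0,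
        mul_one] at h1
      exact h1
    by_cases hq : (fun j => z (Sum.inr j)) = 0
    · apply hz
      have hq' : ∀ j, z (Sum.inr j) = 0 := fun j => congrFun hq j
      ext (i | j)
      · have h1 := (hl i).trans_le hc1
        have h2 : (fun j => (z (Sum.inr j) : ℝ)) = 0 := funext fun j => by simp [hq']
        rw [h2, Matrix.mulVec_zero, Pi.zero_apply, add_zero] at h1
        exact Int.abs_lt_one_iff.1 (by exact_mod_cast h1)
      · exact hq' j
    · refine hno ⟨fun j => z (Sum.inr j), ?_, ?_, ?_⟩
      · refine (intDist_le _ fun i => -z (Sum.inl i)).trans_lt ?_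
        rw [pi_norm_lt_iff hc0]
        intro i
        have h1 := hl i
        simp only [Pi.sub_apply, Int.cast_neg, sub_neg_eq_add, Real.norm_eq_abs]
        rwa [add_comm]
      · rw [norm_pos_iff]
        intro h0
        exact hq (funext fun j => by simpa using congrFun h0 j)
      · rw [pi_norm_lt_iff hR0]
        exact hr
  obtain ⟨z, hz⟩ := exists_intVec_norm_map_sub_le f (by rw [hdet]; exact hΔ0.ne') hf
    (⌊ε ^ (-(m : ℤ))⌋₊ + 1)
    (by rw [hdet, abs_of_pos hΔ0]; exact_mod_cast Nat.lt_floor_add_one _) (Sum.elim b 0)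
  have hz' : ‖f (Sum.elim b 0 - intVec _ z)‖ ≤ (1 / 2) * (ε ^ (-(m : ℤ)) + 1) := by
    refine hz.trans ?_
    push_cast
    have := Nat.floor_le hΔ0.le
    linarith
  have hK : 0 ≤ (1 / 2) * (ε ^ (-(m : ℤ)) + 1) := by positivity
  rw [pi_norm_le_iff_of_nonneg hK] at hz'
  refine ⟨fun j => z (Sum.inr j), ?_, ?_⟩
  · refine (intDist_le _ fun i => -z (Sum.inl i)).trans ?_
    rw [mul_assoc, ← hc, pi_norm_le_iff_of_nonneg (by positivity)]
    intro i
    have h1 := hz' (Sum.inl i)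
    rw [hfl, Real.norm_eq_abs, abs_mul, abs_of_pos (inv_pos.2 hc0), inv_mul_le_iff₀ hc0,
      mul_comm c] at h1
    refine le_of_eq_of_le ?_ h1
    have h2 : (fun j => ((Sum.elim b 0 : Fin m ⊕ Fin n → ℝ) - intVec _ z) (Sum.inr j))
        = -fun j => (z (Sum.inr j) : ℝ) := funext fun j => by simp
    rw [h2, Matrix.mulVec_neg, Real.norm_eq_abs, ← abs_neg]
    congr 1
    simp only [Pi.sub_apply, Pi.neg_apply, Sum.elim_inl, intVec_apply, Int.cast_neg]
    ring
  · rw [pi_norm_le_iff_of_nonneg (by positivity)]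
    intro j
    have h1 := hz' (Sum.inr j)
    rw [hfr, Real.norm_eq_abs, abs_mul, abs_of_pos (inv_pos.2 hR0), inv_mul_le_iff₀ hR0,
      mul_comm R] at h1
    simpa using h1
end

section
/- (Weyl type uniform distribution) Let m, n be positive integers and A ∈ M_{m,n}(ℝ). Suppose that the subgroup G(^tA) = (^tA)ℤ^m + ℤ^n of ℝ^n has maximal rank m+n over ℤ (equivalently, (^tA)c + p = 0 with c ∈ ℤ^m, p ∈ ℤ^n forces c = 0 and p = 0). Then the sequence {Aq}_{q∈ℤ^n} is uniformly distributed in 𝕋^m in the following sense: for every ball B ⊂ 𝕋^m, #{q ∈ ℤ^n : ‖q‖ ≤ N and Aq mod ℤ^m ∈ B} / #{q ∈ ℤ^n : ‖q‖ ≤ N} → |B| as N → ∞. -/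
open MeasureTheory Filter

/-- Weyl's criterion: convergence of all Fourier coefficients implies weak convergence of
probability measures on the torus. -/
theorem tendsto_of_tendsto_integral_mFourier {d ι : Type*} [Fintype d] {l : Filter ι}
    {μ : ι → ProbabilityMeasure (UnitAddTorus d)} {μ₀ : ProbabilityMeasure (UnitAddTorus d)}
    (h : ∀ c : d → ℤ, Tendsto (fun i => ∫ x, UnitAddTorus.mFourier c x ∂(μ i : Measure _)) l
      (nhds (∫ x, UnitAddTorus.mFourier c x ∂(μ₀ : Measure _)))) :
    Tendsto μ l (nhds μ₀) := by
  have hint (f : C(UnitAddTorus d, ℂ)) (ν : ProbabilityMeasure (UnitAddTorus d)) :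
      Integrable f (ν : Measure _) :=
    (BoundedContinuousFunction.mkOfCompact f).integrable _
  have key (f : C(UnitAddTorus d, ℂ))
      (hf : f ∈ Submodule.span ℂ (Set.range UnitAddTorus.mFourier)) :
      Tendsto (fun i => ∫ x, f x ∂(μ i : Measure _)) l (nhds (∫ x, f x ∂(μ₀ : Measure _))) := by
    induction hf using Submodule.span_induction with
    | mem f hf =>
      obtain ⟨c, rfl⟩ := hf
      exact h c
    | zero => simpa using tendsto_const_nhds
    | add f g _ _ hf hg =>
      simp only [ContinuousMap.add_apply, integral_add (hint f _) (hint g _)]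
      exact hf.add hg
    | smul a f _ hf =>
      simp only [ContinuousMap.smul_apply, integral_smul]
      exact hf.const_smul a
  refine ProbabilityMeasure.tendsto_of_tight_of_separatesPoints ℂ .of_compactSpace
    (A := (UnitAddTorus.mFourierSubalgebra d).comap
      (BoundedContinuousFunction.toContinuousMapStarₐ ℂ)) ?_ fun g hg => key g.toContinuousMap
        (UnitAddTorus.mFourierSubalgebra_coe.le hg)
  intro x y hxy
  obtain ⟨_, ⟨f, hf, rfl⟩, hne⟩ := UnitAddTorus.mFourierSubalgebra_separatesPoints hxy
  exact ⟨f, ⟨f, ⟨BoundedContinuousFunction.mkOfCompact f, hf, rfl⟩, rfl⟩, hne⟩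

theorem UnitAddCircle.integral_fourier_of_ne_zero {k : ℤ} (hk : k ≠ 0) :
    ∫ x : UnitAddCircle, fourier k x = 0 :=
  integral_eq_zero_of_add_right_eq_neg (fourier_add_half_inv_index hk one_pos)

theorem UnitAddTorus.integral_mFourier {d : Type*} [Fintype d] (c : d → ℤ) [Decidable (c = 0)] :
    ∫ x : d → AddCircle (1 : ℝ), UnitAddTorus.mFourier c x = if c = 0 then 1 else 0 := by
  simp only [UnitAddTorus.mFourier, ContinuousMap.coe_mk]
  rw [integral_fintype_prod_volume_eq_prod]
  split_ifs with hc
  · simp [hc, measureReal_def]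
  · obtain ⟨i, hi⟩ := Function.ne_iff.mp hc
    exact Finset.prod_eq_zero (Finset.mem_univ i) (UnitAddCircle.integral_fourier_of_ne_zero hi)

theorem fourier_sub_one_mul_sum_Icc (x : AddCircle (1 : ℝ)) (N : ℕ) :
    (fourier 1 x - 1) * ∑ k ∈ Finset.Icc (-N : ℤ) N, (fourier k x : ℂ) =
      fourier (N + 1) x - fourier (-N) x := by
  induction N with
  | zero => simp
  | succ N ih =>
    have h : Finset.Icc (-(N + 1 : ℕ) : ℤ) (N + 1 : ℕ) =
        insert (-(N + 1 : ℤ)) (insert (N + 1 : ℤ) (Finset.Icc (-N : ℤ) N)) := by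
      ext k
      simp only [Finset.mem_insert, Finset.mem_Icc]
      omega
    rw [h, Finset.sum_insert (by simp; omega), Finset.sum_insert (by simp)]
    rw [mul_add, mul_add, ih, sub_mul, sub_mul, ← fourier_add, ← fourier_add]
    push_cast
    rw [show (1 : ℤ) + -(N + 1) = -N by ring, show (1 : ℤ) + (N + 1) = N + 1 + 1 by ring]
    ring

/-- Averages of the characters of the circle at a fixed point over `[-N, N]`. -/
theorem tendsto_average_fourier (x : AddCircle (1 : ℝ)) [Decidable (x = 0)] :
    Tendsto (fun N : ℕ => (2 * N + 1 : ℂ)⁻¹ * ∑ k ∈ Finset.Icc (-N : ℤ) N, (fourier k x : ℂ))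
      atTop (nhds (if x = 0 then 1 else 0)) := by
  split_ifs with hx
  · refine tendsto_const_nhds.congr fun N => ?_
    have h : ((2 * N + 1 : ℕ) : ℂ) ≠ 0 := Nat.cast_ne_zero.mpr (by omega)
    have hc : ((N : ℤ) + 1 + N).toNat = 2 * N + 1 := by omega
    push_cast at h
    simp [hx, hc, h]
  · have hne : (fourier 1 x : ℂ) - 1 ≠ 0 := by
      rw [sub_ne_zero, fourier_one]
      intro h
      refine hx (AddCircle.injective_toCircle one_ne_zero ?_)
      rw [AddCircle.toCircle_zero]
      exact Subtype.ext h
    have hpos : 0 < ‖(fourier 1 x : ℂ) - 1‖ := norm_pos_iff.mpr hne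
    have hlim : Tendsto (fun N : ℕ => ((2 * N + 1 : ℕ) : ℝ)⁻¹ * (2 / ‖(fourier 1 x : ℂ) - 1‖))
        atTop (nhds 0) := by
      have h : Tendsto (fun N : ℕ => 2 * N + 1) atTop atTop :=
        tendsto_atTop_mono (fun N => show N ≤ 2 * N + 1 by omega) tendsto_id
      simpa using ((tendsto_inv_atTop_nhds_zero_nat (𝕜 := ℝ)).comp h).mul_const
        (2 / ‖(fourier 1 x : ℂ) - 1‖)
    refine squeeze_zero_norm (fun N => ?_) hlim
    rw [norm_mul, norm_inv, show (2 * N + 1 : ℂ) = ((2 * N + 1 : ℕ) : ℂ) by push_cast; rfl,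
      Complex.norm_natCast]
    gcongr
    rw [le_div_iff₀ hpos, mul_comm, ← norm_mul, fourier_sub_one_mul_sum_Icc]
    refine (norm_sub_le _ _).trans ?_
    simp only [fourier_apply, Circle.norm_coe]
    norm_num

/-- The integer points of the cube `[-N, N]^n`. -/
noncomputable def intBox (n N : ℕ) : Finset (Fin n → ℤ) :=
  Fintype.piFinset fun _ => Finset.Icc (-N : ℤ) N

theorem coe_intBox (n N : ℕ) :
    (intBox n N : Set (Fin n → ℤ)) = {q | ‖(fun j => (q j : ℝ))‖ ≤ N} := by
  ext q
  simp only [intBox, Finset.mem_coe, Fintype.mem_piFinset, Finset.mem_Icc, Set.mem_ofPred_eq,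
    pi_norm_le_iff_of_nonneg (Nat.cast_nonneg (α := ℝ) N), Real.norm_eq_abs, abs_le]
  exact_mod_cast Iff.rfl

theorem card_intBox (n N : ℕ) : (intBox n N).card = (2 * N + 1) ^ n := by
  have hc : ((N : ℤ) + 1 + N).toNat = 2 * N + 1 := by omega
  simp [intBox, hc]

theorem intBox_nonempty (n N : ℕ) : (intBox n N).Nonempty := by
  rw [← Finset.card_pos, card_intBox]
  positivity

theorem mFourier_torusProj_mulVec {m n : ℕ} (A : Matrix (Fin m) (Fin n) ℝ) (c : Fin m → ℤ)
    (q : Fin n → ℤ) :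
    UnitAddTorus.mFourier c (torusProj (A.mulVec fun j => (q j : ℝ))) =
      ∏ j, (fourier (q j)
        ((A.transpose.mulVec (fun i => (c i : ℝ)) j : ℝ) : AddCircle (1 : ℝ)) : ℂ) := by
  simp only [UnitAddTorus.mFourier, ContinuousMap.coe_mk, torusProj, fourier_coe_apply,
    Matrix.mulVec, dotProduct, Matrix.transpose_apply, ← Complex.exp_sum]
  push_cast
  simp only [Finset.mul_sum, Finset.sum_div]
  rw [Finset.sum_comm]
  congr! 3
  ring

theorem tendsto_average_mFourier_torusProj {m n : ℕ} (A : Matrix (Fin m) (Fin n) ℝ)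
    (hrank : ∀ (c : Fin m → ℤ) (p : Fin n → ℤ),
      A.transpose.mulVec (fun i => (c i : ℝ)) + (fun j => (p j : ℝ)) = 0 → c = 0 ∧ p = 0)
    (c : Fin m → ℤ) :
    Tendsto (fun N : ℕ => ((intBox n N).card : ℂ)⁻¹ *
        ∑ q ∈ intBox n N, UnitAddTorus.mFourier c (torusProj (A.mulVec fun j => (q j : ℝ))))
      atTop (nhds (if c = 0 then 1 else 0)) := by
  classical
  set θ : Fin n → AddCircle (1 : ℝ) :=
    fun j => ((A.transpose.mulVec (fun i => (c i : ℝ)) j : ℝ) : AddCircle (1 : ℝ)) with hθ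
  have hlim := tendsto_finsetProd Finset.univ fun j _ => tendsto_average_fourier (θ j)
  have hval : ∏ j, (if θ j = 0 then 1 else 0 : ℂ) = if c = 0 then 1 else 0 := by
    split_ifs with hc
    · refine Finset.prod_eq_one fun j _ => if_pos ?_
      simp [hθ, hc, Matrix.mulVec, dotProduct]
    · by_contra hprod
      have hzero (j : Fin n) : θ j = 0 := by
        by_contra hj
        exact hprod (Finset.prod_eq_zero (Finset.mem_univ j) (if_neg hj))
      choose p hp using fun j => (AddCircle.coe_eq_zero_iff (1 : ℝ)).mp (hzero j)
      refine hc (hrank c (-p) ?_).1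
      ext j
      simp [← hp]
  rw [hval] at hlim
  refine hlim.congr fun N => ?_
  rw [Finset.prod_mul_distrib, ← Finset.sum_prod_piFinset, card_intBox]
  simp only [mFourier_torusProj_mulVec, intBox]
  simp [hθ]

theorem integral_uniformOn_finset {Ω E : Type*} [MeasurableSpace Ω] [MeasurableSingletonClass Ω]
    [NormedAddCommGroup E] [NormedSpace ℝ E] [CompleteSpace E] (s : Finset Ω) (f : Ω → E) :
    ∫ x, f x ∂(ProbabilityTheory.uniformOn (s : Set Ω)) = (s.card : ℝ)⁻¹ • ∑ x ∈ s, f x := by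
  have hf : IntegrableOn f (s : Set Ω) Measure.count := by
    rw [← Set.biUnion_of_singleton (s : Set Ω), integrableOn_finite_biUnion s.finite_toSet]
    exact fun x _ => integrableOn_singleton (by simp) (by simp)
  rw [ProbabilityTheory.uniformOn, ProbabilityTheory.cond, integral_smul_measure,
    setIntegral_finset _ hf]
  simp [measureReal_def]

theorem UnitAddTorus.volume_frontier_ball {d : Type*} [Fintype d] (x : d → AddCircle (1 : ℝ))
    {r : ℝ} (hr : 0 < r) : volume (frontier (Metric.ball x r)) = 0 := by
  have h : Metric.ball x r =ᵐ[volume] Metric.closedBall x r := by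
    rw [ball_pi x hr, closedBall_pi x hr.le]
    exact Measure.ae_eq_set_pi fun i _ => AddCircle.closedBall_ae_eq_ball.symm
  refine measure_mono_null ?_ (ae_le_set.mp h.symm.le)
  rw [frontier, Metric.isOpen_ball.interior_eq]
  exact Set.sdiff_subset_sdiff_left Metric.closure_ball_subset_closedBall

/-- Weyl type uniform distribution: if `G(ᵗA) = ᵗAℤ^m + ℤ^n` has maximal rank `m + n`
over `ℤ`, then `{Aq}_{q ∈ ℤ^n}` is uniformly distributed in `𝕋^m` in the radial sense:
for every ball `B ⊂ 𝕋^m`,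
`#{q : ‖q‖ ≤ N, Aq mod ℤ^m ∈ B} / #{q : ‖q‖ ≤ N} → |B|` as `N → ∞`. -/
theorem weyl_uniform_distribution (m n : ℕ) (hm : 0 < m) (hn : 0 < n)
    (A : Matrix (Fin m) (Fin n) ℝ)
    (hrank : ∀ (c : Fin m → ℤ) (p : Fin n → ℤ),
      A.transpose.mulVec (fun i => (c i : ℝ)) + (fun j => (p j : ℝ)) = 0 →
      c = 0 ∧ p = 0) :
    ∀ (x : Fin m → AddCircle (1 : ℝ)) (r : ℝ), 0 < r →
      Tendsto (fun N : ℕ =>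
        ({q : Fin n → ℤ | ‖(fun j => (q j : ℝ))‖ ≤ N ∧
            torusProj (A.mulVec (fun j => (q j : ℝ))) ∈ Metric.ball x r}.ncard : ℝ) /
        ({q : Fin n → ℤ | ‖(fun j => (q j : ℝ))‖ ≤ N}.ncard : ℝ))
        atTop (nhds (volume (Metric.ball x r)).toReal) := by
  intro x r hr
  have hprob : IsProbabilityMeasure (volume : Measure (AddCircle (1 : ℝ))) :=
    ⟨by simp [AddCircle.measure_univ]⟩
  let T : (Fin n → ℤ) → UnitAddTorus (Fin m) := fun q => torusProj (A.mulVec fun j => (q j : ℝ))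
  have hT : Measurable T := measurable_of_countable T
  have hunif (N : ℕ) : IsProbabilityMeasure
      (ProbabilityTheory.uniformOn (intBox n N : Set (Fin n → ℤ))) :=
    ProbabilityTheory.isProbabilityMeasure_uniformOn (Finset.finite_toSet _) (intBox_nonempty n N)
  let μ : ℕ → ProbabilityMeasure (UnitAddTorus (Fin m)) := fun N =>
    ⟨(ProbabilityTheory.uniformOn (intBox n N : Set (Fin n → ℤ))).map T,
      Measure.isProbabilityMeasure_map hT.aemeasurable⟩
  let μ₀ : ProbabilityMeasure (UnitAddTorus (Fin m)) :=
    ⟨(volume : Measure (Fin m → AddCircle (1 : ℝ))), inferInstance⟩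
  have hμ : Tendsto μ atTop (nhds μ₀) := by
    refine tendsto_of_tendsto_integral_mFourier fun c => ?_
    have hlim := tendsto_average_mFourier_torusProj A hrank c
    rw [← UnitAddTorus.integral_mFourier c] at hlim
    refine hlim.congr fun N => ?_
    change _ = ∫ y, UnitAddTorus.mFourier c y
      ∂((ProbabilityTheory.uniformOn (intBox n N : Set (Fin n → ℤ))).map T)
    rw [integral_map hT.aemeasurable (by fun_prop), integral_uniformOn_finset]
    simp [T]
  have hball := (ENNReal.tendsto_toReal (measure_ne_top _ _)).comp
    (ProbabilityMeasure.tendsto_measure_of_null_frontier_of_tendsto' hμ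
      (UnitAddTorus.volume_frontier_ball x hr))
  refine hball.congr fun N => ?_
  have hfin := (intBox n N).finite_toSet.inter_of_left (T ⁻¹' Metric.ball x r)
  change (((ProbabilityTheory.uniformOn (intBox n N : Set (Fin n → ℤ))).map T)
    (Metric.ball x r)).toReal = _
  rw [Measure.map_apply hT measurableSet_ball, ProbabilityTheory.uniformOn,
    ProbabilityTheory.cond_apply (Finset.measurableSet _), ENNReal.toReal_mul, ENNReal.toReal_inv,
    ← coe_intBox, Set.ncard_coe_finset, Measure.count_apply_finset, div_eq_inv_mul,
    Measure.count_apply_finite _ hfin, ← Set.ncard_eq_toFinset_card _ hfin, coe_intBox]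
  simp only [ENNReal.toReal_natCast]
  rfl
end
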